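/- Let k ≥ 3 and t ≥ 1 be integers. There exists n₀ such that for all n ≥ n₀, any k-uniform hypergraph on vertex set [n] with exactly C(n−1,k−1) + C(n−2,k−1) + … + C(n−t,k−1) edges and containing no k-uniform linear path of length 2t+1 consists exactly of all k-subsets of [n] that meet some fixed t-element set S. -/

import Mathlib

/-- A `k`-uniform linear path of length `ℓ`: a list of `k`-sets `F₁, …, F_ℓ` such that
`|F_i ∩ F_{i+1}| = 1` for consecutive sets and `F_i ∩ F_j = ∅` whenever `|i - j| > 1`. -/
def IsLinearPath (k ℓ : ℕ) {n : ℕ} (A : Fin ℓ → Finset (Fin n)) : Prop :=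
  (∀ i, (A i).card = k) ∧
  (∀ i j : Fin ℓ, (j : ℕ) = (i : ℕ) + 1 → (A i ∩ A j).card = 1) ∧
  (∀ i j : Fin ℓ, (i : ℕ) + 1 < (j : ℕ) → Disjoint (A i) (A j))

/-- `PathTo H m U v`: the hypergraph `H` has a linear path of length `m` whose vertices lie in `U`
and which can be continued at the vertex `v`, a vertex of its last edge only. -/
inductive PathTo {V : Type*} [DecidableEq V] (H : Finset (Finset V)) : ℕ → Finset V → V → Prop
  | nil (v : V) : PathTo H 0 {v} v
  | cons {m : ℕ} {U : Finset V} {v w : V} {e : Finset V} : PathTo H m U v → e ∈ H →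
      e ∩ U = {v} → w ∈ e → w ≠ v → PathTo H (m + 1) (U ∪ e) w

namespace PathTo

variable {V : Type*} [DecidableEq V] {H : Finset (Finset V)} {m k : ℕ} {U : Finset V} {v : V}

theorem mem (h : PathTo H m U v) : v ∈ U := by
  cases h with
  | nil => simp
  | cons _ _ _ hw _ => exact Finset.mem_union_right _ hw

theorem card_le (h : PathTo H m U v) (hk : ∀ e ∈ H, e.card = k) : U.card ≤ k * m + 1 := by
  induction h with
  | nil => simp
  | cons _ he _ _ _ ih =>
    refine (Finset.card_union_le _ _).trans ?_
    rw [hk _ he]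
    linarith

theorem mono {H' : Finset (Finset V)} (h : PathTo H m U v) (hH : H ⊆ H') : PathTo H' m U v := by
  induction h with
  | nil v => exact .nil v
  | cons _ he h1 h2 h3 ih => exact .cons ih (hH he) h1 h2 h3

theorem exists_of_le (h : PathTo H m U v) {m' : ℕ} (hm : m' ≤ m) : ∃ U' v', PathTo H m' U' v' := by
  induction h with
  | nil v =>
    obtain rfl : m' = 0 := by omega
    exact ⟨_, _, .nil v⟩
  | @cons m U v w e h he h1 h2 h3 ih =>
    rcases Nat.lt_or_ge m' (m + 1) with h' | h'
    · exact ih (by omega)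
    · obtain rfl := le_antisymm hm h'
      exact ⟨_, _, .cons h he h1 h2 h3⟩

/-- Continue a path with an edge through its end vertex that avoids the rest of the path. -/
theorem extend (h : PathTo H m U v) {e : Finset V} (he : e ∈ H) (hv : v ∈ e)
    (hd : Disjoint e (U.erase v)) {w : V} (hw : w ∈ e) (hwv : w ≠ v) :
    PathTo H (m + 1) (U ∪ e) w := by
  refine .cons h he ?_ hw hwv
  ext x
  have := h.mem
  simp only [Finset.mem_inter, Finset.mem_singleton]
  constructor
  · rintro ⟨h1, h2⟩
    by_contra hne
    exact Finset.disjoint_left.1 hd h1 (Finset.mem_erase.2 ⟨hne, h2⟩)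
  · rintro rfl
    exact ⟨hv, this⟩

theorem single {e : Finset V} (he : e ∈ H) (hv : v ∈ e) (h2 : 2 ≤ e.card) : PathTo H 1 e v := by
  obtain ⟨w, hw, hwv⟩ := Finset.exists_mem_ne (by omega : 1 < e.card) v
  have := (PathTo.nil (H := H) w).cons he (by simpa using hw) hv (Ne.symm hwv)
  rwa [Finset.union_eq_right.2 (by simpa using hw)] at this

/-- A set `Y` of vertices at which every short path can be continued, ending again in `Y`. -/
theorem exists_of_forall_extend (Y : Set V) (hY : Y.Nonempty) (l : ℕ)
    (hstep : ∀ m U, ∀ y ∈ Y, m < l → PathTo H m U y →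
      ∃ m' U', ∃ y' ∈ Y, m < m' ∧ PathTo H m' U' y') : ∃ U v, PathTo H l U v := by
  have key : ∀ j ≤ l, ∃ m U, ∃ y ∈ Y, j ≤ m ∧ PathTo H m U y := by
    intro j
    induction j with
    | zero =>
      intro _
      obtain ⟨y, hy⟩ := hY
      exact ⟨0, _, y, hy, le_rfl, .nil y⟩
    | succ j ih =>
      intro hj
      obtain ⟨m, U, y, hy, hm, hp⟩ := ih (by omega)
      rcases Nat.lt_or_ge m l with h | h
      · obtain ⟨m', U', y', hy', hm', hp'⟩ := hstep m U y hy h hp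
        exact ⟨m', U', y', hy', by omega, hp'⟩
      · exact ⟨m, U, y, hy, by omega, hp⟩
  obtain ⟨m, U, y, -, hm, hp⟩ := key l le_rfl
  exact hp.exists_of_le hm

end PathTo

theorem PathTo.exists_isLinearPath {n k m : ℕ} {H : Finset (Finset (Fin n))} {U : Finset (Fin n)}
    {v : Fin n} (h : PathTo H m U v) (hk : ∀ e ∈ H, e.card = k) :
    ∃ A : Fin m → Finset (Fin n), IsLinearPath k m A ∧ ∀ i, A i ∈ H := by
  suffices ∃ A : Fin m → Finset (Fin n), IsLinearPath k m A ∧ (∀ i, A i ∈ H) ∧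
      (∀ i, A i ⊆ U) ∧ (∀ i : Fin m, (i : ℕ) + 1 = m → v ∈ A i) ∧
      (∀ i : Fin m, (i : ℕ) + 1 < m → v ∉ A i) by
    obtain ⟨A, h1, h2, -⟩ := this
    exact ⟨A, h1, h2⟩
  induction h with
  | nil v => exact ⟨fun i => i.elim0, ⟨fun i => i.elim0, fun i => i.elim0, fun i => i.elim0⟩,
      fun i => i.elim0, fun i => i.elim0, fun i => i.elim0, fun i => i.elim0⟩
  | @cons m U v w e hp he hU hw hwv ih =>
    obtain ⟨A, ⟨hA1, hA2, hA3⟩, hAH, hAU, hlast, hprev⟩ := ih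
    have hmem : ∀ x, x ∈ e → x ∈ U → x = v := fun x h1 h2 => by
      have : x ∈ e ∩ U := Finset.mem_inter.2 ⟨h1, h2⟩
      rw [hU] at this
      simpa using this
    have hve : v ∈ e := by
      have : v ∈ e ∩ U := by rw [hU]; simp
      exact (Finset.mem_inter.1 this).1
    refine ⟨Fin.snoc (α := fun _ => Finset (Fin n)) A e, ⟨?_, ?_, ?_⟩, ?_, ?_, ?_, ?_⟩
    · intro i
      induction i using Fin.lastCases with
      | last => simpa using hk e he
      | cast i => simpa using hA1 i
    · intro i j hij
      induction j using Fin.lastCases with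
      | last =>
        induction i using Fin.lastCases with
        | last => simp at hij
        | cast i =>
          simp only [Fin.snoc_castSucc, Fin.snoc_last]
          simp only [Fin.val_last, Fin.val_castSucc] at hij
          rw [Finset.card_eq_one]
          refine ⟨v, ?_⟩
          ext x
          simp only [Finset.mem_inter, Finset.mem_singleton]
          constructor
          · rintro ⟨h1, h2⟩
            exact hmem x h2 (hAU i h1)
          · rintro rfl
            exact ⟨hlast i hij.symm, hve⟩
      | cast j =>
        induction i using Fin.lastCases with
        | last =>
          simp only [Fin.val_last, Fin.val_castSucc] at hij
          omega
        | cast i =>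
          simp only [Fin.snoc_castSucc]
          exact hA2 i j (by simpa using hij)
    · intro i j hij
      induction j using Fin.lastCases with
      | last =>
        induction i using Fin.lastCases with
        | last => simp at hij
        | cast i =>
          simp only [Fin.snoc_castSucc, Fin.snoc_last]
          simp only [Fin.val_last, Fin.val_castSucc] at hij
          rw [Finset.disjoint_left]
          intro x h1 h2
          obtain rfl := hmem x h2 (hAU i h1)
          exact hprev i hij h1
      | cast j =>
        induction i using Fin.lastCases with
        | last =>
          simp only [Fin.val_last, Fin.val_castSucc] at hij
          omega
        | cast i =>
          simp only [Fin.snoc_castSucc]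
          exact hA3 i j (by simpa using hij)
    · intro i
      induction i using Fin.lastCases with
      | last => simpa using he
      | cast i => simpa using hAH i
    · intro i
      induction i using Fin.lastCases with
      | last => simp
      | cast i => simpa using (hAU i).trans Finset.subset_union_left
    · intro i hi
      induction i using Fin.lastCases with
      | last => simpa using hw
      | cast i =>
        simp only [Fin.val_castSucc] at hi
        omega
    · intro i hi
      induction i using Fin.lastCases with
      | last => simp at hi
      | cast i =>
        simp only [Fin.snoc_castSucc]
        exact fun h' => hwv (hmem w hw (hAU i h'))

section Peeling

variable {V : Type*} [Fintype V] [DecidableEq V]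

/-- In a hypergraph all of whose codegrees are large, edges through a vertex can avoid any small
set. -/
theorem exists_edge_disjoint_of_full {H : Finset (Finset V)} {d : ℕ}
    (hfull : ∀ e ∈ H, ∀ u ∈ e,
      d < ({x | x ∉ e.erase u ∧ insert x (e.erase u) ∈ H} : Finset V).card)
    {e₀ : Finset V} (he₀ : e₀ ∈ H) {v : V} (hv : v ∈ e₀) {W : Finset V} (hvW : v ∉ W)
    (hW : W.card ≤ d) : ∃ e ∈ H, v ∈ e ∧ Disjoint e W := by
  obtain ⟨e, he, hmin⟩ := Finset.exists_min_image (H.filter (v ∈ ·)) (fun e => (e ∩ W).card)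
    ⟨e₀, by simp [he₀, hv]⟩
  simp only [Finset.mem_filter] at he hmin
  refine ⟨e, he.1, he.2, ?_⟩
  by_contra hd
  rw [Finset.not_disjoint_iff] at hd
  obtain ⟨u, hue, huW⟩ := hd
  have h1 := hfull e he.1 u hue
  obtain ⟨x, hx, hxW⟩ := Finset.exists_mem_notMem_of_card_lt_card (hW.trans_lt h1)
  simp only [Finset.mem_filter, Finset.mem_univ, true_and] at hx
  have hvu : v ≠ u := fun h => hvW (h ▸ huW)
  have := hmin (insert x (e.erase u))
    ⟨hx.2, Finset.mem_insert_of_mem (Finset.mem_erase.2 ⟨hvu, he.2⟩)⟩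
  have hlt : (insert x (e.erase u) ∩ W).card < (e ∩ W).card := by
    apply Finset.card_lt_card
    rw [Finset.insert_inter_of_notMem hxW]
    refine ⟨Finset.inter_subset_inter_right (Finset.erase_subset _ _), fun h => ?_⟩
    have := h (Finset.mem_inter.2 ⟨hue, huW⟩)
    simp at this
  omega

theorem exists_pathTo_of_full {H : Finset (Finset V)} {k l : ℕ} (hk : 2 ≤ k)
    (hH : ∀ e ∈ H, e.card = k) (hne : H.Nonempty)
    (hfull : ∀ e ∈ H, ∀ u ∈ e,
      k * l < ({x | x ∉ e.erase u ∧ insert x (e.erase u) ∈ H} : Finset V).card) :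
    ∃ U v, PathTo H l U v := by
  refine PathTo.exists_of_forall_extend {v | ∃ e ∈ H, v ∈ e} ?_ l ?_
  · obtain ⟨e, he⟩ := hne
    obtain ⟨v, hv⟩ := Finset.card_pos.1 (by rw [hH e he]; omega)
    exact ⟨v, e, he, hv⟩
  · rintro m U y ⟨e₀, he₀, hy⟩ hm hp
    have h1 := hp.card_le hH
    have h2 : (U.erase y).card ≤ k * l := by
      rw [Finset.card_erase_of_mem hp.mem]
      have : k * m ≤ k * l := Nat.mul_le_mul_left _ hm.le
      omega
    obtain ⟨e, he, hye, hd⟩ :=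
      exists_edge_disjoint_of_full hfull he₀ hy (Finset.notMem_erase y U) h2
    obtain ⟨w, hw, hwy⟩ := Finset.exists_mem_ne (by rw [hH e he]; omega : 1 < e.card) y
    exact ⟨m + 1, _, w, ⟨e, he, hw⟩, by omega, hp.extend he hye hd hw hwy⟩

/-- A hypergraph without subgraphs of large codegree splits into small stars with distinct
centres. -/
theorem exists_peeling (d : ℕ) (H : Finset (Finset V))
    (hH : ∀ H' ⊆ H, H'.Nonempty → ∃ e ∈ H', ∃ u ∈ e,
      ({x | x ∉ e.erase u ∧ insert x (e.erase u) ∈ H'} : Finset V).card ≤ d) :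
    ∃ L : Finset V → Finset V, (∀ f, ∀ x ∈ L f, x ∉ f ∧ insert x f ∈ H) ∧
      (∀ f, (L f).card ≤ d) ∧ H.card ≤ ∑ f, (L f).card := by
  induction H using Finset.strongInduction with
  | H H ih =>
    rcases H.eq_empty_or_nonempty with rfl | hne
    · exact ⟨fun _ => ∅, by simp, by simp, by simp⟩
    obtain ⟨e, he, u, hu, hd⟩ := hH H subset_rfl hne
    set f := e.erase u with hf
    set N : Finset V := {x | x ∉ f ∧ insert x f ∈ H} with hN
    set H' := H \ N.image (insert · f) with hH'
    have heN : e ∈ N.image (insert · f) := by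
      refine Finset.mem_image.2 ⟨u, ?_, Finset.insert_erase hu⟩
      simp [hN, hf, Finset.insert_erase hu, he]
    have hss : H' ⊂ H := ⟨Finset.sdiff_subset, fun h => (Finset.mem_sdiff.1 (h he)).2 heN⟩
    obtain ⟨L, hL1, hL2, hL3⟩ := ih H' hss fun H'' h => hH H'' (h.trans hss.1)
    have hLf : L f = ∅ := by
      rw [Finset.eq_empty_iff_forall_notMem]
      intro x hx
      obtain ⟨h1, h2⟩ := hL1 f x hx
      rw [hH', Finset.mem_sdiff] at h2
      exact h2.2 (Finset.mem_image_of_mem _ (by simp [hN, h1, h2.1]))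
    refine ⟨Function.update L f N, fun g x hx => ?_, fun g => ?_, ?_⟩
    · by_cases hg : g = f
      · subst hg
        simpa [hN] using hx
      · rw [Function.update_of_ne hg] at hx
        exact ⟨(hL1 g x hx).1, hss.1 (hL1 g x hx).2⟩
    · by_cases hg : g = f
      · subst hg
        simpa using hd
      · rw [Function.update_of_ne hg]
        exact hL2 g
    · have h1 : H.card ≤ H'.card + N.card := by
        have h2 : H.card - (N.image (insert · f)).card ≤ H'.card := Finset.le_card_sdiff _ _
        have h3 : (N.image (insert · f)).card ≤ N.card := Finset.card_image_le
        omega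
      have h2 : ∑ g, (Function.update L f N g).card = ∑ g, (L g).card + N.card := by
        rw [← Finset.add_sum_erase _ _ (Finset.mem_univ f),
          ← Finset.add_sum_erase (a := f) _ (fun g => (L g).card) (Finset.mem_univ f), hLf]
        have : ∑ g ∈ Finset.univ.erase f, (Function.update L f N g).card =
            ∑ g ∈ Finset.univ.erase f, (L g).card := by
          refine Finset.sum_congr rfl fun g hg => ?_
          rw [Function.update_of_ne (Finset.ne_of_mem_erase hg)]
        rw [this]
        simp [add_comm]
      omega

/-- The edges of a hypergraph without linear paths of length `l`, distributed over few vertices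
per set of size `k - 1`. -/
theorem exists_peeling_of_pathFree {H : Finset (Finset V)} {k l : ℕ} (hk : 2 ≤ k)
    (hH : ∀ e ∈ H, e.card = k) (hfree : ∀ U v, ¬ PathTo H l U v) :
    ∃ L : Finset V → Finset V, (∀ f, ∀ x ∈ L f, x ∉ f ∧ insert x f ∈ H) ∧
      (∀ f, (L f).card ≤ k * l) ∧
      H.card ≤ ∑ f ∈ Finset.powersetCard (k - 1) Finset.univ, (L f).card := by
  obtain ⟨L, h1, h2, h3⟩ := exists_peeling (k * l) H (by
    intro H' hss hne
    by_contra! hcon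
    obtain ⟨U, v, hp⟩ := exists_pathTo_of_full hk (fun e he => hH e (hss he)) hne hcon
    exact hfree U v (hp.mono hss))
  refine ⟨L, h1, h2, h3.trans_eq ?_⟩
  symm
  refine Finset.sum_subset (Finset.subset_univ _) fun f _ hf => ?_
  rw [Finset.card_eq_zero, Finset.eq_empty_iff_forall_notMem]
  intro x hx
  obtain ⟨hxf, he⟩ := h1 f x hx
  have := hH _ he
  rw [Finset.card_insert_of_notMem hxf] at this
  exact hf (by simp; omega)

theorem card_le_of_pathFree {H : Finset (Finset V)} {k l : ℕ} (hk : 2 ≤ k)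
    (hH : ∀ e ∈ H, e.card = k) (hfree : ∀ U v, ¬ PathTo H l U v) {X : Finset V}
    (hX : ∀ e ∈ H, e ⊆ X) : H.card ≤ k * l * X.card ^ (k - 1) := by
  obtain ⟨L, h1, h2, h3⟩ := exists_peeling_of_pathFree hk hH hfree
  have h4 : ∑ f ∈ Finset.powersetCard (k - 1) Finset.univ, (L f).card =
      ∑ f ∈ Finset.powersetCard (k - 1) X, (L f).card := by
    symm
    refine Finset.sum_subset (Finset.powersetCard_mono (Finset.subset_univ _)) fun f hf hfX => ?_
    rw [Finset.card_eq_zero, Finset.eq_empty_iff_forall_notMem]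
    intro x hx
    refine hfX (Finset.mem_powersetCard.2 ⟨?_, (Finset.mem_powersetCard.1 hf).2⟩)
    exact (Finset.subset_insert x f).trans (hX _ (h1 f x hx).2)
  rw [h4] at h3
  refine h3.trans ((Finset.sum_le_card_nsmul _ _ _ fun f _ => h2 f).trans ?_)
  rw [Finset.card_powersetCard, smul_eq_mul, mul_comm]
  exact Nat.mul_le_mul_left _ (Nat.choose_le_pow _ _)

end Peeling

section Counting

variable {V : Type*} [Fintype V] [DecidableEq V]

theorem card_filter_superset_le (A : Finset V) (r : ℕ) :
    ({f ∈ Finset.powersetCard (r + A.card) Finset.univ | A ⊆ f} : Finset (Finset V)).card ≤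
      Fintype.card V ^ r := by
  calc _ ≤ (Finset.powersetCard r (Finset.univ : Finset V)).card := by
        refine Finset.card_le_card_of_injOn (· \ A) ?_ ?_
        · intro f hf
          rw [Finset.mem_coe, Finset.mem_filter, Finset.mem_powersetCard] at hf
          rw [Finset.mem_coe, Finset.mem_powersetCard]
          refine ⟨Finset.subset_univ _, ?_⟩
          rw [Finset.card_sdiff_of_subset hf.2, hf.1.2]
          omega
        · intro f hf g hg hfg
          rw [Finset.mem_coe, Finset.mem_filter] at hf hg
          rw [← Finset.sdiff_union_of_subset hf.2, ← Finset.sdiff_union_of_subset hg.2]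
          simp only at hfg
          rw [hfg]
    _ ≤ _ := by
        rw [Finset.card_powersetCard, Finset.card_univ]
        exact Nat.choose_le_pow _ _

theorem card_filter_mem_le (r : ℕ) (y : V) :
    ({f ∈ Finset.powersetCard (r + 1) Finset.univ | y ∈ f} : Finset (Finset V)).card ≤
      Fintype.card V ^ r := by
  simpa using card_filter_superset_le {y} r

theorem card_filter_mem_mem_le (r : ℕ) {y z : V} (h : y ≠ z) :
    ({f ∈ Finset.powersetCard (r + 2) Finset.univ | y ∈ f ∧ z ∈ f} : Finset (Finset V)).card ≤
      Fintype.card V ^ r := by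
  simpa [Finset.card_pair h, Finset.insert_subset_iff] using card_filter_superset_le {y, z} r

/-- The number of sets through `y` which meet a given set not containing `y`. -/
theorem card_filter_not_disjoint_le (r : ℕ) {y : V} {W : Finset V} (h : y ∉ W) :
    ({f ∈ Finset.powersetCard (r + 2) Finset.univ | y ∈ f ∧ ¬ Disjoint f W} :
      Finset (Finset V)).card ≤ W.card * Fintype.card V ^ r := by
  refine (Finset.card_le_card (t := W.biUnion fun w =>
    {f ∈ Finset.powersetCard (r + 2) Finset.univ | y ∈ f ∧ w ∈ f}) ?_).trans ?_
  · intro f hf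
    simp only [Finset.mem_filter, Finset.not_disjoint_iff] at hf
    obtain ⟨hf, hy, w, hw, hwW⟩ := hf
    simp only [Finset.mem_biUnion, Finset.mem_filter]
    exact ⟨w, hwW, hf, hy, hw⟩
  · refine Finset.card_biUnion_le_card_mul _ _ _ fun w hw => ?_
    exact card_filter_mem_mem_le r fun h' => h (h' ▸ hw)

theorem card_filter_meets_le (r : ℕ) (S : Finset V) :
    ({f ∈ Finset.powersetCard (r + 1) Finset.univ | ∃ s ∈ S, s ∈ f} :
      Finset (Finset V)).card ≤ S.card * Fintype.card V ^ r := by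
  refine (Finset.card_le_card (t := S.biUnion fun w =>
    {f ∈ Finset.powersetCard (r + 1) Finset.univ | w ∈ f}) ?_).trans ?_
  · intro f hf
    simp only [Finset.mem_filter, Finset.mem_biUnion] at hf ⊢
    obtain ⟨hf, w, hw, hwW⟩ := hf
    exact ⟨w, hw, hf, hwW⟩
  · exact Finset.card_biUnion_le_card_mul _ _ _ fun w _ => card_filter_mem_le r w

theorem sum_card_filter_mem_eq (F : Finset (Finset V)) :
    ∑ y, (F.filter (y ∈ ·)).card = ∑ f ∈ F, f.card := by
  simp only [Finset.card_filter]
  rw [Finset.sum_comm]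
  simp

/-- Every family with enough members contains a nonempty subfamily in which each index incident
to a member is incident to many members. -/
theorem exists_clean_subfamily {α ι : Type*} [DecidableEq α] [DecidableEq ι] (R : α → Finset ι)
    (w : ι → ℕ) (Q : ℕ) (I : Finset ι) (F : Finset α) (hR : ∀ f ∈ F, R f ⊆ I)
    (hw : ∑ i ∈ I, w i < Q * F.card) :
    ∃ F' ⊆ F, F'.Nonempty ∧ ∀ f ∈ F', ∀ i ∈ R f, w i ≤ Q * (F'.filter (i ∈ R ·)).card := by
  induction I using Finset.strongInduction generalizing F with
  | H I ih =>
    by_cases hgood : ∀ f ∈ F, ∀ i ∈ R f, w i ≤ Q * (F.filter (i ∈ R ·)).card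
    · refine ⟨F, subset_rfl, ?_, hgood⟩
      rw [Finset.nonempty_iff_ne_empty]
      rintro rfl
      simp at hw
    push Not at hgood
    obtain ⟨f, hf, i, hi, hlt⟩ := hgood
    have hiI := hR f hf hi
    obtain ⟨F', h1, h2, h3⟩ := ih (I.erase i) (Finset.erase_ssubset hiI) (F.filter (i ∉ R ·))
      (fun g hg j hj => by
        simp only [Finset.mem_filter] at hg
        exact Finset.mem_erase.2 ⟨fun h => hg.2 (h ▸ hj), hR g hg.1 hj⟩)
      (by
        have h4 := Finset.card_filter_add_card_filter_not (s := F) (i ∈ R ·)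
        have h5 := Finset.add_sum_erase I w hiI
        rw [← h4, mul_add] at hw
        omega)
    exact ⟨F', h1.trans (Finset.filter_subset _ _), h2, h3⟩

end Counting

section LocallyHeavy

open scoped Classical in
/-- The colour `c` is used by a proportion of at least `1 / C` of the sets through `y`. -/
def LocallyHeavy {V : Type*} [Fintype V] (r C : ℕ) (G : Finset (Finset V)) (a : Finset V → V)
    (y c : V) : Prop :=
  Fintype.card V ^ (r + 1) ≤ C * (G.filter fun f => y ∈ f ∧ a f = c).card

variable {V : Type*} [Fintype V]

open scoped Classical in
theorem card_locallyHeavy_colours_le {r C : ℕ} {G : Finset (Finset V)}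
    (hG : G ⊆ Finset.powersetCard (r + 2) Finset.univ) (a : Finset V → V) (y : V) :
    ({c | LocallyHeavy r C G a y c} : Finset V).card ≤ C := by
  have hN : 0 < Fintype.card V := Fintype.card_pos_iff.2 ⟨y⟩
  refine Nat.le_of_mul_le_mul_right (c := Fintype.card V ^ (r + 1)) ?_ (by positivity)
  calc ({c | LocallyHeavy r C G a y c} : Finset V).card * Fintype.card V ^ (r + 1)
      ≤ ∑ c ∈ {c | LocallyHeavy r C G a y c}, C * (G.filter fun f => y ∈ f ∧ a f = c).card := by
        rw [← smul_eq_mul]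
        exact Finset.card_nsmul_le_sum _ _ _ fun c hc => (Finset.mem_filter.1 hc).2
    _ ≤ ∑ c, C * (G.filter fun f => y ∈ f ∧ a f = c).card :=
        Finset.sum_le_sum_of_subset (Finset.subset_univ _)
    _ = C * (G.filter (y ∈ ·)).card := by
        rw [← Finset.mul_sum, Finset.card_eq_sum_card_fiberwise (f := a) (t := Finset.univ)
          (fun _ _ => Finset.mem_coe.2 (Finset.mem_univ _))]
        simp only [Finset.filter_filter]
    _ ≤ C * Fintype.card V ^ (r + 1) := by
        refine Nat.mul_le_mul_left _ (le_trans (Finset.card_le_card ?_)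
          (card_filter_mem_le (r + 1) y))
        intro f hf
        rw [Finset.mem_filter] at hf ⊢
        exact ⟨hG hf.1, hf.2⟩

open scoped Classical in
theorem mul_card_locallyHeavy_vertices_le {r C D : ℕ} {G : Finset (Finset V)}
    (hG : G ⊆ Finset.powersetCard (r + 2) Finset.univ) {a : Finset V → V} {c : V}
    (hD : D * (G.filter fun f => a f = c).card ≤ Fintype.card V ^ (r + 2)) :
    D * ({y | LocallyHeavy r C G a y c} : Finset V).card ≤ C * (r + 2) * Fintype.card V := by
  have hN : 0 < Fintype.card V := Fintype.card_pos_iff.2 ⟨c⟩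
  refine Nat.le_of_mul_le_mul_right (c := Fintype.card V ^ (r + 1)) ?_ (by positivity)
  have h1 : ({y | LocallyHeavy r C G a y c} : Finset V).card * Fintype.card V ^ (r + 1) ≤
      C * ((r + 2) * (G.filter fun f => a f = c).card) := by
    calc _ ≤ ∑ y ∈ {y | LocallyHeavy r C G a y c},
          C * (G.filter fun f => y ∈ f ∧ a f = c).card := by
          rw [← smul_eq_mul]
          exact Finset.card_nsmul_le_sum _ _ _ fun c hc => (Finset.mem_filter.1 hc).2
      _ ≤ ∑ y, C * (G.filter fun f => y ∈ f ∧ a f = c).card :=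
          Finset.sum_le_sum_of_subset (Finset.subset_univ _)
      _ = C * ∑ f ∈ G.filter (fun f => a f = c), f.card := by
          rw [← Finset.mul_sum]
          congr 1
          rw [← sum_card_filter_mem_eq]
          refine Finset.sum_congr rfl fun y _ => ?_
          rw [Finset.filter_filter]
          congr 1
          ext f
          simp [and_comm]
      _ = _ := by
          congr 1
          rw [Finset.sum_const_nat (m := r + 2), mul_comm]
          intro f hf
          exact (Finset.mem_powersetCard.1 (hG (Finset.mem_filter.1 hf).1)).2
  calc D * ({y | LocallyHeavy r C G a y c} : Finset V).card * Fintype.card V ^ (r + 1)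
      = D * (({y | LocallyHeavy r C G a y c} : Finset V).card * Fintype.card V ^ (r + 1)) := by
        ring
    _ ≤ D * (C * ((r + 2) * (G.filter fun f => a f = c).card)) := Nat.mul_le_mul_left _ h1
    _ = C * (r + 2) * (D * (G.filter fun f => a f = c).card) := by ring
    _ ≤ C * (r + 2) * Fintype.card V ^ (r + 2) := Nat.mul_le_mul_left _ hD
    _ = _ := by ring

open scoped Classical in
/-- Few sets have a colour which is locally heavy at two of their vertices. -/
theorem mul_card_doubly_heavy_le {r C D : ℕ} {G : Finset (Finset V)}
    (hG : G ⊆ Finset.powersetCard (r + 2) Finset.univ) {a : Finset V → V}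
    (hD : ∀ c, D * (G.filter fun f => a f = c).card ≤ Fintype.card V ^ (r + 2)) :
    D * (G.filter fun f => ∃ y ∈ f, ∃ z ∈ f, y ≠ z ∧ LocallyHeavy r C G a y (a f) ∧
      LocallyHeavy r C G a z (a f)).card ≤ C ^ 2 * (r + 2) * Fintype.card V ^ (r + 2) := by
  set N := Fintype.card V
  set hv : V → Finset V := fun y => {c | LocallyHeavy r C G a y c} with hhv
  set hc : V → Finset V := fun c => {y | LocallyHeavy r C G a y c} with hhc
  have h1 : (G.filter fun f => ∃ y ∈ f, ∃ z ∈ f, y ≠ z ∧ LocallyHeavy r C G a y (a f) ∧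
      LocallyHeavy r C G a z (a f)).card ≤ ∑ y, ∑ c ∈ hv y, (hc c).card * N ^ r := by
    refine (Finset.card_le_card (t := Finset.univ.biUnion fun y => (hv y).biUnion fun c =>
      ((hc c).filter (y ≠ ·)).biUnion fun z =>
        {f ∈ Finset.powersetCard (r + 2) Finset.univ | y ∈ f ∧ z ∈ f}) ?_).trans ?_
    · intro f hf
      rw [Finset.mem_filter] at hf
      obtain ⟨hf, y, hy, z, hz, hyz, h1, h2⟩ := hf
      simp only [Finset.mem_biUnion, Finset.mem_filter]
      exact ⟨y, Finset.mem_univ _, a f, by simpa [hhv] using h1, z,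
        ⟨by simpa [hhc] using h2, hyz⟩, hG hf, hy, hz⟩
    · refine Finset.card_biUnion_le.trans (Finset.sum_le_sum fun y _ => ?_)
      refine Finset.card_biUnion_le.trans (Finset.sum_le_sum fun c _ => ?_)
      refine (Finset.card_biUnion_le_card_mul _ _ (N ^ r) fun z hz => ?_).trans ?_
      · have := card_filter_mem_mem_le r (Finset.mem_filter.1 hz).2
        convert this
      · exact Nat.mul_le_mul_right _ (Finset.card_filter_le _ _)
  calc _ ≤ D * ∑ y, ∑ c ∈ hv y, (hc c).card * N ^ r := Nat.mul_le_mul_left _ h1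
    _ = ∑ y, ∑ c ∈ hv y, D * (hc c).card * N ^ r := by
        simp only [Finset.mul_sum, mul_assoc]
    _ ≤ ∑ y : V, ∑ c ∈ hv y, C * (r + 2) * N * N ^ r := by
        refine Finset.sum_le_sum fun y _ => Finset.sum_le_sum fun c _ => ?_
        exact Nat.mul_le_mul_right _ (mul_card_locallyHeavy_vertices_le hG (hD c))
    _ ≤ ∑ y : V, C * (C * (r + 2) * N * N ^ r) := by
        refine Finset.sum_le_sum fun y _ => ?_
        rw [Finset.sum_const, smul_eq_mul]
        exact Nat.mul_le_mul_right _ (card_locallyHeavy_colours_le hG a y)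
    _ = _ := by
        rw [Finset.sum_const, smul_eq_mul, Finset.card_univ]
        ring

open scoped Classical in
theorem mul_card_light_colour_le {r C : ℕ} (G : Finset (Finset V)) (a : Finset V → V) (y : V)
    (W : Finset V) :
    C * (G.filter fun f => y ∈ f ∧ ¬ LocallyHeavy r C G a y (a f) ∧ a f ∈ W).card ≤
      W.card * Fintype.card V ^ (r + 1) := by
  calc _ ≤ C * ∑ w ∈ W.filter (fun w => ¬ LocallyHeavy r C G a y w),
        (G.filter fun f => y ∈ f ∧ a f = w).card := by
        refine Nat.mul_le_mul_left _ ((Finset.card_le_card ?_).trans Finset.card_biUnion_le)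
        intro f hf
        simp only [Finset.mem_filter, Finset.mem_biUnion] at hf ⊢
        exact ⟨a f, ⟨hf.2.2.2, hf.2.2.1⟩, hf.1, hf.2.1, rfl⟩
    _ = ∑ w ∈ W.filter (fun w => ¬ LocallyHeavy r C G a y w),
        C * (G.filter fun f => y ∈ f ∧ a f = w).card := Finset.mul_sum _ _ _
    _ ≤ (W.filter (fun w => ¬ LocallyHeavy r C G a y w)).card * Fintype.card V ^ (r + 1) := by
        rw [← smul_eq_mul (α := ℕ)]
        refine Finset.sum_le_card_nsmul _ _ _ fun w hw => ?_
        exact (not_le.1 (Finset.mem_filter.1 hw).2).le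
    _ ≤ _ := Nat.mul_le_mul_right _ (Finset.card_filter_le _ _)

open scoped Classical in
/-- Among many sets through `y`, one avoids a given small set `W`, and so do those of its two
colours which are not locally heavy at `y`. -/
theorem exists_avoiding {r C K Q : ℕ} {G F : Finset (Finset V)}
    (hG : G ⊆ Finset.powersetCard (r + 2) Finset.univ) (hFG : F ⊆ G) (a b : Finset V → V)
    {y : V} (hF : ∀ f ∈ F, y ∈ f) {W : Finset V} (hyW : y ∉ W) (hW : W.card ≤ K)
    (hFcard : Fintype.card V ^ (r + 1) ≤ Q * F.card) (hC : C = 4 * Q * (K + 1))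
    (hn : C < Fintype.card V) :
    ∃ f ∈ F, Disjoint f W ∧ (¬ LocallyHeavy r C G a y (a f) → a f ∉ W) ∧
      (¬ LocallyHeavy r C G b y (b f) → b f ∉ W) := by
  set N := Fintype.card V
  by_contra! hcon
  have hsub : F ⊆ (({f ∈ Finset.powersetCard (r + 2) Finset.univ | y ∈ f ∧ ¬ Disjoint f W} :
      Finset (Finset V)) ∪ (G.filter fun f => y ∈ f ∧ ¬ LocallyHeavy r C G a y (a f) ∧ a f ∈ W)) ∪
      (G.filter fun f => y ∈ f ∧ ¬ LocallyHeavy r C G b y (b f) ∧ b f ∈ W) := by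
    intro f hf
    have h1 := hcon f hf
    simp only [Finset.mem_union, Finset.mem_filter]
    by_cases h2 : Disjoint f W
    · by_cases h3 : ¬ LocallyHeavy r C G a y (a f) ∧ a f ∈ W
      · exact .inl (.inr ⟨hFG hf, hF f hf, h3⟩)
      · have := h1 h2 (by tauto)
        exact .inr ⟨hFG hf, hF f hf, this⟩
    · exact .inl (.inl ⟨hG (hFG hf), hF f hf, h2⟩)
  have h1 := (Finset.card_le_card hsub).trans
    ((Finset.card_union_le _ _).trans (Nat.add_le_add_right (Finset.card_union_le _ _) _))
  have h2 : ({f ∈ Finset.powersetCard (r + 2) Finset.univ | y ∈ f ∧ ¬ Disjoint f W} :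
      Finset (Finset V)).card ≤ W.card * N ^ r := by
    convert card_filter_not_disjoint_le r hyW
  have h3 := mul_card_light_colour_le (r := r) (C := C) G a y W
  have h4 := mul_card_light_colour_le (r := r) (C := C) G b y W
  change _ ≤ W.card * N ^ (r + 1) at h3 h4
  have hN : 0 < N := by omega
  have hpos : 0 < N ^ (r + 1) := by positivity
  have hF1 : C * F.card ≤ K * (C * N ^ r) + 2 * K * N ^ (r + 1) := by
    have h5 := Nat.mul_le_mul_left C h1
    have h6 : W.card * N ^ r ≤ K * N ^ r := Nat.mul_le_mul_right _ hW
    have h7 : W.card * N ^ (r + 1) ≤ K * N ^ (r + 1) := Nat.mul_le_mul_right _ hW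
    have h8 := Nat.mul_le_mul_left C (h2.trans h6)
    nlinarith
  have hF2 : 4 * (K + 1) * N ^ (r + 1) ≤ C * F.card := by
    have := Nat.mul_le_mul_left (4 * (K + 1)) hFcard
    rw [hC]
    nlinarith
  have hF3 : C * N ^ r ≤ N ^ (r + 1) := by
    rw [pow_succ, mul_comm]
    exact Nat.mul_le_mul_left _ hn.le
  have hF4 := Nat.mul_le_mul_left K hF3
  nlinarith

end LocallyHeavy

section LightColours

variable {V : Type*} [Fintype V] [DecidableEq V]

/-- Linear paths exist if many sets have two vertices with a colour that is not locally heavy. -/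
theorem exists_pathTo_of_two_light_vertices {r l B C : ℕ} {H G G₁ : Finset (Finset V)}
    (hH : ∀ e ∈ H, e.card = r + 3) (hG : G ⊆ Finset.powersetCard (r + 2) Finset.univ)
    {a b : Finset V → V} (ha : ∀ f ∈ G, a f ∉ f ∧ insert (a f) f ∈ H)
    (hb : ∀ f ∈ G, b f ∉ f ∧ insert (b f) f ∈ H)
    (hC : C = 4 * (8 * B) * ((r + 3) * l + 1)) (hn : C < Fintype.card V) (hG₁ : G₁ ⊆ G)
    (h₁ : ∀ f ∈ G₁, ∃ p ∈ f, ∃ q ∈ f, p ≠ q ∧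
      (¬ LocallyHeavy r C G a p (a f) ∨ ¬ LocallyHeavy r C G b p (b f)) ∧
      (¬ LocallyHeavy r C G a q (a f) ∨ ¬ LocallyHeavy r C G b q (b f)))
    (hcard : Fintype.card V ^ (r + 2) < 4 * B * G₁.card) : ∃ U v, PathTo H l U v := by
  classical
  set R : Finset V → Finset V := fun f => f.filter fun p =>
    ¬ LocallyHeavy r C G a p (a f) ∨ ¬ LocallyHeavy r C G b p (b f) with hR
  obtain ⟨G₂, hG₂, hne, hclean⟩ := exists_clean_subfamily R
    (fun _ => Fintype.card V ^ (r + 1)) (4 * B) Finset.univ G₁ (fun _ _ => Finset.subset_univ _)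
    (by rw [Finset.sum_const, smul_eq_mul, Finset.card_univ]
        calc _ = Fintype.card V ^ (r + 2) := by ring
          _ < _ := hcard)
  have hR2 : ∀ f ∈ G₂, ∀ y, ∃ y' ∈ R f, y' ≠ y := by
    intro f hf y
    obtain ⟨p, hp, q, hq, hpq, hp', hq'⟩ := h₁ f (hG₂ hf)
    refine Finset.exists_mem_ne (Finset.one_lt_card.2 ⟨p, ?_, q, ?_, hpq⟩) y
    · exact Finset.mem_filter.2 ⟨hp, hp'⟩
    · exact Finset.mem_filter.2 ⟨hq, hq'⟩
  refine PathTo.exists_of_forall_extend {y | ∃ f ∈ G₂, y ∈ R f} ?_ l ?_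
  · obtain ⟨f, hf⟩ := hne
    obtain ⟨p, hp, -⟩ := h₁ f (hG₂ hf)
    obtain ⟨y, hy, -⟩ := hR2 f hf p
    exact ⟨y, f, hf, hy⟩
  · rintro m U y ⟨f₀, hf₀, hy⟩ hm hp
    have hW : (U.erase y).card ≤ (r + 3) * l := by
      have h1 := hp.card_le hH
      rw [Finset.card_erase_of_mem hp.mem]
      have : (r + 3) * m ≤ (r + 3) * l := Nat.mul_le_mul_left _ hm.le
      omega
    have h2 := hclean f₀ hf₀ y hy
    obtain ⟨f, hf, hd, hfa, hfb⟩ := exists_avoiding (r := r) (C := C) (Q := 8 * B)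
      (F := G₂.filter (y ∈ R ·)) hG
      ((Finset.filter_subset _ _).trans (hG₂.trans hG₁)) a b
      (fun f hf => (Finset.mem_filter.1 (Finset.mem_filter.1 hf).2).1)
      (Finset.notMem_erase y U) hW (h2.trans (Nat.mul_le_mul_right _ (by omega))) hC hn
    rw [Finset.mem_filter] at hf
    have hfG := hG₁ (hG₂ hf.1)
    obtain ⟨y', hy', hne'⟩ := hR2 f hf.1 y
    have hy'f := (Finset.mem_filter.1 hy').1
    obtain ⟨hyf, hlight⟩ := Finset.mem_filter.1 hf.2
    rcases hlight with hl | hl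
    · exact ⟨m + 1, _, y', ⟨f, hf.1, hy'⟩, by omega,
        hp.extend (ha f hfG).2 (Finset.mem_insert_of_mem hyf)
        (Finset.disjoint_insert_left.2 ⟨hfa hl, hd⟩) (Finset.mem_insert_of_mem hy'f) hne'⟩
    · exact ⟨m + 1, _, y', ⟨f, hf.1, hy'⟩, by omega,
        hp.extend (hb f hfG).2 (Finset.mem_insert_of_mem hyf)
        (Finset.disjoint_insert_left.2 ⟨hfb hl, hd⟩) (Finset.mem_insert_of_mem hy'f) hne'⟩

/-- In a `3`-graph, linear paths exist if many pairs have two colours which are both locally heavy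
at the same vertex only. -/
theorem exists_pathTo_of_two_heavy_colours {l B C : ℕ} {H G G₁ : Finset (Finset V)}
    (hH : ∀ e ∈ H, e.card = 3) (hG : G ⊆ Finset.powersetCard 2 Finset.univ)
    {a b : Finset V → V} (ha : ∀ f ∈ G, a f ∉ f ∧ insert (a f) f ∈ H)
    (hb : ∀ f ∈ G, b f ∉ f ∧ insert (b f) f ∈ H) (hab : ∀ f ∈ G, a f ≠ b f)
    (hC : C = 4 * (8 * B) * (3 * l + 1)) (hB : 1 ≤ B)
    (hn : 8 * B * C ^ 2 * (3 * l + 1) < Fintype.card V) (hG₁ : G₁ ⊆ G)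
    (h₁ : ∀ f ∈ G₁, ∃ y z, y ≠ z ∧ f = {y, z} ∧
      LocallyHeavy 0 C G a y (a f) ∧ LocallyHeavy 0 C G b y (b f) ∧
      ¬ LocallyHeavy 0 C G a z (a f) ∧ ¬ LocallyHeavy 0 C G b z (b f))
    (hcard : Fintype.card V ^ 2 < 4 * B * G₁.card) : ∃ U v, PathTo H l U v := by
  classical
  have hCpos : 0 < C := by rw [hC]; positivity
  set N := Fintype.card V with hN
  have hCn : C < N := by
    refine lt_of_le_of_lt ?_ hn
    calc C ≤ C ^ 2 := Nat.le_self_pow two_ne_zero C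
      _ = 1 * C ^ 2 * 1 := by ring
      _ ≤ 8 * B * C ^ 2 * (3 * l + 1) := by gcongr <;> omega
  have hex : Nonempty V := Fintype.card_pos_iff.1 (by omega)
  choose! yy zz hyz using h₁
  set R : Finset V → Finset (V ⊕ V × V × V) := fun f => {.inl (zz f), .inr (yy f, a f, b f)}
    with hR
  set T : Finset (V × V × V) := Finset.univ.biUnion fun y =>
    ((Finset.univ.filter (LocallyHeavy 0 C G a y)) ×ˢ
      (Finset.univ.filter (LocallyHeavy 0 C G b y))).image fun c => (y, c) with hT
  have hTcard : T.card ≤ N * C ^ 2 := by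
    refine Finset.card_biUnion_le_card_mul _ _ _ fun y _ => Finset.card_image_le.trans ?_
    rw [Finset.card_product, sq]
    refine Nat.mul_le_mul ?_ ?_
    · convert card_locallyHeavy_colours_le hG a y
    · convert card_locallyHeavy_colours_le hG b y
  obtain ⟨G₂, hG₂, hne, hclean⟩ := exists_clean_subfamily R
    (Sum.elim (fun _ => C ^ 2 * N) (fun _ => N)) (2 * C ^ 2 * (4 * B))
    (Finset.univ.disjSum T) G₁ (fun f hf => by
      intro i hi
      simp only [hR, Finset.mem_insert, Finset.mem_singleton] at hi
      rcases hi with rfl | rfl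
      · simp
      · obtain ⟨-, -, h1, h2, -⟩ := hyz f hf
        simp only [Finset.inr_mem_disjSum, hT, Finset.mem_biUnion, Finset.mem_univ, true_and,
          Finset.mem_image, Finset.mem_product, Finset.mem_filter]
        exact ⟨yy f, (a f, b f), ⟨h1, h2⟩, rfl⟩)
    (by
      rw [Finset.sum_disjSum]
      simp only [Sum.elim_inl, Sum.elim_inr, Finset.sum_const, smul_eq_mul, Finset.card_univ]
      rw [← hN]
      have h1 : T.card * N ≤ N * C ^ 2 * N := Nat.mul_le_mul_right _ hTcard
      have h2 : C ^ 2 * N ^ 2 < C ^ 2 * (4 * B * G₁.card) :=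
        Nat.mul_lt_mul_of_pos_left hcard (pow_pos hCpos 2)
      nlinarith)
  have hbound : ∀ m U y, m ≤ l → PathTo H m U y → (U.erase y).card ≤ 3 * l := by
    intro m U y hm hp
    have h1 := hp.card_le hH
    rw [Finset.card_erase_of_mem hp.mem]
    omega
  refine PathTo.exists_of_forall_extend {z | ∃ f ∈ G₂, z = zz f} ?_ l ?_
  · obtain ⟨f, hf⟩ := hne
    exact ⟨_, f, hf, rfl⟩
  · rintro m U z ⟨f₀, hf₀, rfl⟩ hm hp
    set z := zz f₀ with hz
    have hW := hbound m U z hm.le hp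
    have h2 := hclean f₀ hf₀ (.inl z) (by simp [hR, hz])
    simp only [Sum.elim_inl] at h2
    have h2' : N ≤ 8 * B * (G₂.filter (Sum.inl z ∈ R ·)).card := by
      refine Nat.le_of_mul_le_mul_left (c := C ^ 2) ?_ (pow_pos hCpos 2)
      refine h2.trans_eq ?_
      ring
    have hzmem : ∀ f, Sum.inl z ∈ R f ↔ z = zz f := fun f => by simp [hR]
    obtain ⟨f, hf, hd, hfa, hfb⟩ := exists_avoiding (r := 0) (C := C) (Q := 8 * B)
      (F := G₂.filter (Sum.inl z ∈ R ·)) hG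
      ((Finset.filter_subset _ _).trans (hG₂.trans hG₁)) a b
      (fun f hf => by
        rw [Finset.mem_filter, hzmem] at hf
        rw [(hyz f (hG₂ hf.1)).2.1, hf.2]
        simp)
      (Finset.notMem_erase z U) hW (by simpa using h2') hC hCn
    rw [Finset.mem_filter, hzmem] at hf
    obtain ⟨hfG₂, hzf⟩ := hf
    have hfG := hG₁ (hG₂ hfG₂)
    obtain ⟨hne', hfeq, -, -, hla, hlb⟩ := hyz f (hG₂ hfG₂)
    rw [← hzf] at hla hlb hne' hfeq
    have haW := hfa hla
    have hbW := hfb hlb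
    have hzmf : z ∈ f := hfeq.ge (by simp)
    have hymf : yy f ∈ f := hfeq.ge (by simp)
    have hp₁ := hp.extend (ha f hfG).2 (Finset.mem_insert_of_mem hzmf)
      (Finset.disjoint_insert_left.2 ⟨haW, hd⟩) (Finset.mem_insert_of_mem hymf) hne'
    have hW' := hbound _ _ _ (by omega) hp₁
    set W := (U ∪ insert (a f) f).erase (yy f) with hWdef
    set F := G₂.filter (Sum.inr (yy f, a f, b f) ∈ R ·) with hF
    have h3 := hclean f hfG₂ (.inr (yy f, a f, b f)) (by simp [hR])
    simp only [Sum.elim_inr] at h3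
    have hFcard : 3 * l < F.card := by
      by_contra! hcon
      have : 2 * C ^ 2 * (4 * B) * F.card ≤ 2 * C ^ 2 * (4 * B) * (3 * l + 1) :=
        Nat.mul_le_mul_left _ (by omega)
      have := h3.trans this
      refine absurd hn (not_lt.2 (this.trans_eq ?_))
      ring
    have hFmem : ∀ g ∈ F, g ∈ G₂ ∧ yy f = yy g ∧ a f = a g ∧ b f = b g := fun g hg => by
      simpa [hF, hR] using hg
    have hexg : ∃ g ∈ F, Disjoint g W := by
      by_contra! hcon
      have := (Finset.card_le_card fun g hg => Finset.mem_filter.2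
        ⟨hG (hG₁ (hG₂ (hFmem g hg).1)), by
          have h4 := hFmem g hg
          rw [(hyz g (hG₂ h4.1)).2.1, h4.2.1]
          simp, hcon g hg⟩).trans
        (card_filter_not_disjoint_le 0 (Finset.notMem_erase (yy f) (U ∪ insert (a f) f)))
      rw [pow_zero, mul_one] at this
      change F.card ≤ W.card at this
      omega
    obtain ⟨g, hg, hgW⟩ := hexg
    obtain ⟨hgG₂, hgy, hga, hgb⟩ := hFmem g hg
    obtain ⟨hgne, hgeq, -⟩ := hyz g (hG₂ hgG₂)
    rw [← hgy] at hgeq hgne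
    have hp₂ := hp₁.extend (e := insert (b g) g) (w := zz g) (hb g (hG₁ (hG₂ hgG₂))).2
      (Finset.mem_insert_of_mem (hgeq.ge (by simp)))
      (by
        rw [Finset.disjoint_insert_left]
        refine ⟨fun hmem => ?_, hgW⟩
        rw [← hgb, Finset.mem_erase, Finset.mem_union, Finset.mem_insert] at hmem
        obtain ⟨-, h5 | h5 | h5⟩ := hmem
        · exact hbW (Finset.mem_erase.2 ⟨fun h => (hb f hfG).1 (h ▸ hzmf), h5⟩)
        · exact hab f hfG h5.symm
        · exact (hb f hfG).1 h5)
      (Finset.mem_insert_of_mem (hgeq.ge (by simp))) (Ne.symm hgne)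
    exact ⟨_, _, _, ⟨g, hgG₂, rfl⟩, by omega, hp₂⟩

end LightColours

open scoped Classical in
/-- In a hypergraph with no linear path of length `l`, few sets extend to edges in two ways if
each colour is used rarely (when the uniformity is at least `4`, one way suffices). -/
theorem mul_card_rare_colours_le {V : Type*} [Fintype V] {r l B C D : ℕ}
    {H G : Finset (Finset V)} (hH : ∀ e ∈ H, e.card = r + 3)
    (hfree : ∀ U v, ¬ PathTo H l U v) (hG : G ⊆ Finset.powersetCard (r + 2) Finset.univ)
    {a b : Finset V → V} (ha : ∀ f ∈ G, a f ∉ f ∧ insert (a f) f ∈ H)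
    (hb : ∀ f ∈ G, b f ∉ f ∧ insert (b f) f ∈ H) (hab : 1 ≤ r ∨ ∀ f ∈ G, a f ≠ b f)
    (hB : 1 ≤ B) (hC : C = 4 * (8 * B) * ((r + 3) * l + 1)) (hD : 4 * B * (C ^ 2 * (r + 2)) ≤ D)
    (hn : 8 * B * C ^ 2 * ((r + 3) * l + 1) < Fintype.card V)
    (hDa : ∀ c, D * (G.filter fun f => a f = c).card ≤ Fintype.card V ^ (r + 2))
    (hDb : ∀ c, D * (G.filter fun f => b f = c).card ≤ Fintype.card V ^ (r + 2)) :
    B * G.card ≤ Fintype.card V ^ (r + 2) := by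
  set N := Fintype.card V with hN
  have hCpos : 0 < C := by rw [hC]; positivity
  have hCn : C < N := by
    refine lt_of_le_of_lt ?_ hn
    calc C ≤ C ^ 2 := Nat.le_self_pow two_ne_zero C
      _ = 1 * C ^ 2 * 1 := by ring
      _ ≤ 8 * B * C ^ 2 * ((r + 3) * l + 1) := by gcongr <;> omega
  have hbad : ∀ a' : Finset V → V, (∀ c, D * (G.filter fun f => a' f = c).card ≤ N ^ (r + 2)) →
      4 * B * (G.filter fun f => ∃ y ∈ f, ∃ z ∈ f, y ≠ z ∧ LocallyHeavy r C G a' y (a' f) ∧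
      LocallyHeavy r C G a' z (a' f)).card ≤ N ^ (r + 2) := by
    intro a' hDa'
    refine Nat.le_of_mul_le_mul_left (c := C ^ 2 * (r + 2)) ?_ (by positivity)
    refine le_trans ?_ (mul_card_doubly_heavy_le hG hDa')
    rw [← mul_assoc, mul_comm (C ^ 2 * (r + 2))]
    exact Nat.mul_le_mul_right _ hD
  have h1 := hbad a hDa
  have h2 := hbad b hDb
  set G₁ := G.filter fun f => ∃ p ∈ f, ∃ q ∈ f, p ≠ q ∧
    (¬ LocallyHeavy r C G a p (a f) ∨ ¬ LocallyHeavy r C G b p (b f)) ∧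
    (¬ LocallyHeavy r C G a q (a f) ∨ ¬ LocallyHeavy r C G b q (b f)) with hG₁
  have h3 : 4 * B * G₁.card ≤ N ^ (r + 2) := by
    by_contra! hcon
    obtain ⟨U, v, hp⟩ := exists_pathTo_of_two_light_vertices hH hG ha hb hC hCn
      (Finset.filter_subset _ _) (fun f hf => (Finset.mem_filter.1 hf).2) hcon
    exact hfree U v hp
  set G₂ := G.filter fun f => r = 0 ∧ ∃ y z, y ≠ z ∧ f = {y, z} ∧
      LocallyHeavy r C G a y (a f) ∧ LocallyHeavy r C G b y (b f) ∧
      ¬ LocallyHeavy r C G a z (a f) ∧ ¬ LocallyHeavy r C G b z (b f) with hG₂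
  have h4 : 4 * B * G₂.card ≤ N ^ (r + 2) := by
    by_contra! hcon
    have hr : r = 0 := by
      by_contra hr
      simp [hG₂, hr] at hcon
    subst hr
    obtain ⟨U, v, hp⟩ := exists_pathTo_of_two_heavy_colours hH hG ha hb
      (hab.resolve_left (by omega)) hC hB hn
      (Finset.filter_subset _ _) (fun f hf => (Finset.mem_filter.1 hf).2.2) hcon
    exact hfree U v hp
  set G₃ := G.filter fun f => ∃ y ∈ f, ∃ z ∈ f, y ≠ z ∧ LocallyHeavy r C G a y (a f) ∧
      LocallyHeavy r C G a z (a f) with hG₃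
  set G₄ := G.filter fun f => ∃ y ∈ f, ∃ z ∈ f, y ≠ z ∧ LocallyHeavy r C G b y (b f) ∧
      LocallyHeavy r C G b z (b f) with hG₄
  have hcover : G ⊆ G₁ ∪ G₂ ∪ (G₃ ∪ G₄) := by
    intro f hf
    by_contra hcon
    simp only [Finset.mem_union, not_or] at hcon
    obtain ⟨⟨n1, n2⟩, n3, n4⟩ := hcon
    have n1 := fun h => n1 (Finset.mem_filter.2 ⟨hf, h⟩)
    have n2 := fun h => n2 (Finset.mem_filter.2 ⟨hf, h⟩)
    have n3 := fun h => n3 (Finset.mem_filter.2 ⟨hf, h⟩)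
    have n4 := fun h => n4 (Finset.mem_filter.2 ⟨hf, h⟩)
    have hfc : f.card = r + 2 := (Finset.mem_powersetCard.1 (hG hf)).2
    rcases Nat.eq_zero_or_pos r with rfl | hr
    · obtain ⟨p, q, hpq, rfl⟩ := Finset.card_eq_two.1 hfc
      by_cases hp : LocallyHeavy 0 C G a p (a {p, q}) ∧ LocallyHeavy 0 C G b p (b {p, q})
      · exact n2 ⟨rfl, p, q, hpq, rfl, hp.1, hp.2,
          fun h => n3 ⟨p, by simp, q, by simp, hpq, hp.1, h⟩,
          fun h => n4 ⟨p, by simp, q, by simp, hpq, hp.2, h⟩⟩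
      by_cases hq : LocallyHeavy 0 C G a q (a {p, q}) ∧ LocallyHeavy 0 C G b q (b {p, q})
      · exact n2 ⟨rfl, q, p, hpq.symm, Finset.pair_comm p q, hq.1, hq.2,
          fun h => n3 ⟨p, by simp, q, by simp, hpq, h, hq.1⟩,
          fun h => n4 ⟨p, by simp, q, by simp, hpq, h, hq.2⟩⟩
      exact n1 ⟨p, by simp, q, by simp, hpq, not_and_or.1 hp, not_and_or.1 hq⟩
    · have hle : (f.filter fun p => LocallyHeavy r C G a p (a f)).card ≤ 1 := by
        by_contra! hlt
        obtain ⟨p, hp, q, hq, hpq⟩ := Finset.one_lt_card.1 hlt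
        rw [Finset.mem_filter] at hp hq
        exact n3 ⟨p, hp.1, q, hq.1, hpq, hp.2, hq.2⟩
      have := Finset.card_filter_add_card_filter_not (s := f)
        fun p => LocallyHeavy r C G a p (a f)
      obtain ⟨p, hp, q, hq, hpq⟩ := Finset.one_lt_card.1
        (show 1 < (f.filter fun p => ¬ LocallyHeavy r C G a p (a f)).card by omega)
      rw [Finset.mem_filter] at hp hq
      exact n1 ⟨p, hp.1, q, hq.1, hpq, .inl hp.2, .inl hq.2⟩
  have hc : G.card ≤ (G₁.card + G₂.card) + (G₃.card + G₄.card) :=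
    (Finset.card_le_card hcover).trans ((Finset.card_union_le _ _).trans
      (Nat.add_le_add (Finset.card_union_le _ _) (Finset.card_union_le _ _)))
  have := Nat.mul_le_mul_left (4 * B) hc
  linarith

section Rich

variable {V : Type*} [DecidableEq V]

/-- Some edge through the two distinct vertices `s` and `z` avoids any given set of `K` other
vertices. -/
def Rich (H : Finset (Finset V)) (K : ℕ) (s z : V) : Prop :=
  s ≠ z ∧ ∀ W : Finset V, W.card ≤ K → s ∉ W → z ∉ W → ∃ e ∈ H, s ∈ e ∧ z ∈ e ∧ Disjoint e W

/-- A path ending in `Z` can be prolonged by passing through all the vertices of `A` if these are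
richly connected to `Z`. -/
theorem PathTo.exists_chain {H : Finset (Finset V)} {k K : ℕ} (hH : ∀ e ∈ H, e.card = k)
    {Z : Finset V} (hZ : K < Z.card) (A : Finset V) (hR : ∀ s ∈ A, ∀ z ∈ Z, Rich H K s z) {m : ℕ}
    {U : Finset V} {v : V} (hp : PathTo H m U v) (hv : v ∈ Z) (hd : Disjoint U A)
    (hK : k * (m + 2 * A.card) + A.card + 1 ≤ K) :
    ∃ U' v', v' ∈ Z ∧ PathTo H (m + 2 * A.card) U' v' := by
  induction A using Finset.induction_on generalizing m U v with
  | empty => exact ⟨U, v, hv, by simpa using hp⟩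
  | insert s A hs ih =>
    rw [Finset.card_insert_of_notMem hs] at hK ⊢
    rw [Finset.disjoint_insert_right] at hd
    have hU : U.card ≤ k * m + 1 := hp.card_le hH
    have e1 : k * (m + 2 * (A.card + 1)) = k * m + k + k + k * (2 * A.card) := by ring
    obtain ⟨hsv, hrich⟩ := hR s (Finset.mem_insert_self _ _) v hv
    have hAZ : ∀ z ∈ Z, z ∉ A := fun z hz hzA =>
      (hR z (Finset.mem_insert_of_mem hzA) z hz).1 rfl
    obtain ⟨e, he, hse, hve, heW⟩ := hrich (U.erase v ∪ A)
      ((Finset.card_union_le _ _).trans (by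
        rw [Finset.card_erase_of_mem hp.mem]; omega))
      (by simp [hd.1, hs]) (by simp [hAZ v hv])
    rw [Finset.disjoint_union_right] at heW
    have hp₁ := hp.extend he hve heW.1 hse hsv
    have hU₁ : (U ∪ e).card ≤ k * (m + 1) + 1 := hp₁.card_le hH
    obtain ⟨z, hzZ, hzU⟩ := Finset.exists_mem_notMem_of_card_lt_card
      (show (U ∪ e).card < Z.card by rw [mul_add] at hU₁; omega)
    obtain ⟨hsz, hrich'⟩ := hR s (Finset.mem_insert_self _ _) z hzZ
    obtain ⟨e', he', hse', hze', heW'⟩ := hrich' ((U ∪ e).erase s ∪ A)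
      ((Finset.card_union_le _ _).trans (by
        rw [Finset.card_erase_of_mem hp₁.mem]; rw [mul_add] at hU₁; omega))
      (by simp [hs])
      (by simp only [Finset.mem_union, Finset.mem_erase, not_or] at hzU ⊢
          exact ⟨fun h => h.2.elim hzU.1 hzU.2, hAZ z hzZ⟩)
    rw [Finset.disjoint_union_right] at heW'
    have hp₂ := hp₁.extend he' hse' heW'.1 hze' hsz.symm
    obtain ⟨U', v', hv', hp'⟩ := ih (fun s' hs' => hR s' (Finset.mem_insert_of_mem hs')) hp₂ hzZ
      (by simp only [Finset.disjoint_union_left]; exact ⟨⟨hd.2, heW.2⟩, heW'.2⟩)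
      (by have : k * (m + 1 + 1 + 2 * A.card) = k * m + k + k + k * (2 * A.card) := by ring
          omega)
    exact ⟨U', v', hv', by
      rwa [show m + 2 * (A.card + 1) = m + 1 + 1 + 2 * A.card by ring]⟩

/-- If `A` has `t` vertices richly connected to `Z`, an edge that avoids `A` but meets `Z` starts a
linear path of length `2 * t + 1`. -/
theorem exists_pathTo_of_rich {H : Finset (Finset V)} {k K : ℕ} (hH : ∀ e ∈ H, e.card = k)
    (hk : 2 ≤ k) {Z : Finset V} (hZ : K < Z.card) {A : Finset V}
    (hR : ∀ s ∈ A, ∀ z ∈ Z, Rich H K s z) (hK : k * (2 * A.card + 1) + A.card + 1 ≤ K)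
    {e : Finset V} (he : e ∈ H) (hd : Disjoint e A) {z : V} (hze : z ∈ e) (hz : z ∈ Z) :
    ∃ U v, PathTo H (2 * A.card + 1) U v := by
  obtain ⟨U, v, -, hp⟩ := (PathTo.single he hze (hk.trans_eq (hH e he).symm)).exists_chain hH hZ A
    hR hz hd (by rwa [add_comm 1])
  exact ⟨U, v, by rwa [add_comm]⟩

theorem card_filter_not_rich_le [Fintype V] {H : Finset (Finset V)} {K : ℕ} (r : ℕ) {s z : V}
    (h : ¬ Rich H K s z) : ((Finset.powersetCard (r + 2) Finset.univ).filter fun f =>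
      z ∈ f ∧ s ∉ f ∧ insert s f ∈ H).card ≤ K * Fintype.card V ^ r := by
  rcases eq_or_ne s z with rfl | hsz
  · rw [Finset.filter_false_of_mem (by tauto)]
    simp
  · rw [Rich, not_and] at h
    have := h hsz
    push Not at this
    obtain ⟨W, hW, hsW, hzW, hmeet⟩ := this
    refine (Finset.card_le_card ?_).trans
      ((card_filter_not_disjoint_le r hzW).trans (Nat.mul_le_mul_right _ hW))
    intro f
    simp only [Finset.mem_filter]
    rintro ⟨hf, hzf, -, hsf⟩
    refine ⟨hf, hzf, fun hd => ?_⟩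
    exact hmeet _ hsf (Finset.mem_insert_self _ _) (Finset.mem_insert_of_mem hzf)
      (Finset.disjoint_insert_left.2 ⟨hsW, hd⟩)

end Rich

section Typical

open scoped Classical

variable {V : Type*} [Fintype V]

/-- The vertices of `S` that are richly connected to `z`. -/
noncomputable def richType (H : Finset (Finset V)) (K : ℕ) (S : Finset V) (z : V) : Finset V :=
  S.filter fun s => Rich H K s z

/-- A set of `r + 2` vertices whose link, recorded by `L`, looks the way it does for almost all
sets. Here `S` is meant to be the set of vertices that occur in a positive proportion of links. -/
structure Typical (r : ℕ) (H : Finset (Finset V)) (K : ℕ) (S : Finset V) (L : Finset V → Finset V)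
    (f : Finset V) : Prop where
  notMem : ∀ s ∈ S, s ∉ f
  mem_richType : ∀ s ∈ S, s ∈ L f → ∀ z ∈ f, s ∈ richType H K S z
  card_class : ∀ z ∈ f,
    K < (Finset.univ.filter fun z' => richType H K S z' = richType H K S z).card
  card_sdiff : (L f \ S).card ≤ if r = 0 then 1 else 0

theorem card_filter_small_class_le (H : Finset (Finset V)) (K : ℕ) (S : Finset V) :
    (Finset.univ.filter fun z => ¬ K < (Finset.univ.filter fun z' =>
      richType H K S z' = richType H K S z).card).card ≤ K * 2 ^ S.card := by
  refine (Finset.card_le_mul_card_image (f := richType H K S) _ K ?_).trans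
    (Nat.mul_le_mul_left _ ?_)
  · intro A hA
    obtain ⟨z, hz, rfl⟩ := Finset.mem_image.1 hA
    rw [Finset.mem_filter, not_lt] at hz
    refine (Finset.card_le_card fun z' hz' => ?_).trans hz.2
    exact Finset.mem_filter.2 ⟨Finset.mem_univ _, (Finset.mem_filter.1 hz').2⟩
  · rw [← Finset.card_powerset]
    refine Finset.card_le_card fun A hA => ?_
    obtain ⟨z, -, rfl⟩ := Finset.mem_image.1 hA
    exact Finset.mem_powerset.2 (Finset.filter_subset _ _)

/-- Almost all sets are typical. -/
theorem mul_card_not_typical_le {r l B C D K : ℕ} {H : Finset (Finset V)}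
    (hH : ∀ e ∈ H, e.card = r + 3) (hfree : ∀ U v, ¬ PathTo H l U v) {L : Finset V → Finset V}
    (hL : ∀ f, ∀ x ∈ L f, x ∉ f ∧ insert x f ∈ H) {S : Finset V}
    (hS : ∀ x ∉ S, D * ((Finset.powersetCard (r + 2) Finset.univ).filter (x ∈ L ·)).card ≤
      Fintype.card V ^ (r + 2))
    (hB : 1 ≤ B) (hC : C = 4 * (8 * (2 * B)) * ((r + 3) * l + 1))
    (hD : 4 * (2 * B) * (C ^ 2 * (r + 2)) ≤ D)
    (hn : 8 * (2 * B) * C ^ 2 * ((r + 3) * l + 1) < Fintype.card V)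
    (hn' : 2 * B * (S.card + S.card * K + K * 2 ^ S.card) ≤ Fintype.card V) :
    B * ((Finset.powersetCard (r + 2) Finset.univ).filter fun f => ¬ Typical r H K S L f).card ≤
      Fintype.card V ^ (r + 2) := by
  set N := Fintype.card V with hN
  set P : Finset (Finset V) := Finset.powersetCard (r + 2) Finset.univ with hP
  set E₁ := P.filter fun f => ∃ s ∈ S, s ∈ f with hE₁
  have h₁ : E₁.card ≤ S.card * N ^ (r + 1) := card_filter_meets_le (r + 1) S
  set E₂ := P.filter fun f => ∃ s ∈ S, s ∈ L f ∧ ∃ z ∈ f, ¬ Rich H K s z with hE₂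
  have h₂ : E₂.card ≤ S.card * (N * (K * N ^ r)) := by
    refine (Finset.card_le_card (t := S.biUnion fun s =>
      (Finset.univ.filter fun z => ¬ Rich H K s z).biUnion fun z =>
        P.filter fun f => z ∈ f ∧ s ∉ f ∧ insert s f ∈ H) fun f hf => ?_).trans
      (Finset.card_biUnion_le_card_mul _ _ _ fun s hs => ?_)
    · obtain ⟨hfP, s, hs, hsL, z, hz, hsz⟩ := Finset.mem_filter.1 hf
      simp only [Finset.mem_biUnion, Finset.mem_filter, Finset.mem_univ, true_and]
      exact ⟨s, hs, z, hsz, hfP, hz, hL f s hsL⟩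
    · refine (Finset.card_biUnion_le_card_mul _ _ _ fun z hz => ?_).trans
        (Nat.mul_le_mul_right _ (Finset.card_le_univ _))
      exact card_filter_not_rich_le r (Finset.mem_filter.1 hz).2
  set Z := Finset.univ.filter fun z => ¬ K < (Finset.univ.filter fun z' =>
      richType H K S z' = richType H K S z).card with hZ
  set E₃ := P.filter fun f => ∃ s ∈ Z, s ∈ f with hE₃
  have h₃ : E₃.card ≤ K * 2 ^ S.card * N ^ (r + 1) :=
    (card_filter_meets_le (r + 1) Z).trans
      (Nat.mul_le_mul_right _ (card_filter_small_class_le H K S))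
  set E₄ := P.filter fun f => ¬ (L f \ S).card ≤ if r = 0 then 1 else 0 with hE₄
  have h₄ : 2 * B * E₄.card ≤ N ^ (r + 2) := by
    have hex : ∀ f ∈ E₄, ∃ a b, a ∈ L f \ S ∧ b ∈ L f \ S ∧ (1 ≤ r ∨ a ≠ b) := by
      intro f hf
      have := (Finset.mem_filter.1 hf).2
      split_ifs at this with hr
      · obtain ⟨a, ha, b, hb, hab⟩ := Finset.one_lt_card.1 (not_le.1 this)
        exact ⟨a, b, ha, hb, .inr hab⟩
      · obtain ⟨a, ha⟩ := Finset.card_pos.1 (not_le.1 this)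
        exact ⟨a, a, ha, ha, .inl (by omega)⟩
    have : Nonempty V := Fintype.card_pos_iff.1 (by omega)
    choose! a b ha hb hab using hex
    have hcol : ∀ a' : Finset V → V, (∀ f ∈ E₄, a' f ∈ L f \ S) →
        ∀ c, D * (E₄.filter fun f => a' f = c).card ≤ N ^ (r + 2) := by
      intro a' ha' c
      by_cases hc : c ∈ S
      · rw [Finset.filter_false_of_mem]
        · simp
        · rintro f hf rfl
          exact (Finset.mem_sdiff.1 (ha' f hf)).2 hc
      · refine le_trans (Nat.mul_le_mul_left _ (Finset.card_le_card fun f hf => ?_)) (hS c hc)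
        obtain ⟨hfE, rfl⟩ := Finset.mem_filter.1 hf
        exact Finset.mem_filter.2
          ⟨(Finset.mem_filter.1 hfE).1, (Finset.mem_sdiff.1 (ha' f hfE)).1⟩
    refine mul_card_rare_colours_le hH hfree (Finset.filter_subset _ _)
      (fun f hf => hL f _ (Finset.mem_sdiff.1 (ha f hf)).1)
      (fun f hf => hL f _ (Finset.mem_sdiff.1 (hb f hf)).1) ?_ (by omega) hC hD hn
      (hcol a ha) (hcol b hb)
    by_cases hr : 1 ≤ r
    · exact .inl hr
    · exact .inr fun f hf => (hab f hf).resolve_left hr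
  have hcover : (P.filter fun f => ¬ Typical r H K S L f) ⊆ E₁ ∪ E₂ ∪ (E₃ ∪ E₄) := by
    intro f hf
    by_contra hcon
    simp only [Finset.mem_union, not_or] at hcon
    obtain ⟨hfP, hf⟩ := Finset.mem_filter.1 hf
    obtain ⟨⟨n1, n2⟩, n3, n4⟩ := hcon
    have n1 := fun h => n1 (Finset.mem_filter.2 ⟨hfP, h⟩)
    have n2 := fun h => n2 (Finset.mem_filter.2 ⟨hfP, h⟩)
    have n3 := fun h => n3 (Finset.mem_filter.2 ⟨hfP, h⟩)
    have n4 := fun h => n4 (Finset.mem_filter.2 ⟨hfP, h⟩)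
    refine hf ⟨fun s hs hsf => n1 ⟨s, hs, hsf⟩, fun s hs hsL z hz => ?_, fun z hz => ?_,
      not_not.1 n4⟩
    · by_contra hr
      exact n2 ⟨s, hs, hsL, z, hz, fun h => hr (Finset.mem_filter.2 ⟨hs, h⟩)⟩
    · by_contra hr
      exact n3 ⟨z, Finset.mem_filter.2 ⟨Finset.mem_univ _, hr⟩, hz⟩
  have hc : (P.filter fun f => ¬ Typical r H K S L f).card ≤
      (E₁.card + E₂.card) + (E₃.card + E₄.card) :=
    (Finset.card_le_card hcover).trans ((Finset.card_union_le _ _).trans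
      (Nat.add_le_add (Finset.card_union_le _ _) (Finset.card_union_le _ _)))
  have h5 := Nat.mul_le_mul_right (N ^ (r + 1)) hn'
  have h6 : N * N ^ (r + 1) = N ^ (r + 2) := by ring
  have h7 : S.card * (N * (K * N ^ r)) = S.card * K * N ^ (r + 1) := by ring
  rw [h6] at h5
  rw [h7] at h₂
  have h8 := Nat.mul_le_mul_left (2 * B) hc
  have h9 := Nat.mul_le_mul_left (2 * B) (Nat.add_le_add (Nat.add_le_add h₁ h₂) h₃)
  have : 2 * B * (S.card * N ^ (r + 1) + S.card * K * N ^ (r + 1) + K * 2 ^ S.card * N ^ (r + 1))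
    = 2 * B * (S.card + S.card * K + K * 2 ^ S.card) * N ^ (r + 1) := by ring
  nlinarith

/-- Few vertices occur in a positive proportion of links of bounded size. -/
theorem card_popular_le {d D : ℕ} (P : Finset (Finset V)) {M : ℕ} (hM : 0 < M) (hP : P.card ≤ M)
    {L : Finset V → Finset V} (hL : ∀ f, (L f).card ≤ d) :
    (Finset.univ.filter fun x => M < D * (P.filter (x ∈ L ·)).card).card ≤ D * d := by
  refine Nat.le_of_mul_le_mul_right (c := M) ?_ hM
  calc _ ≤ ∑ x ∈ Finset.univ.filter (fun x => M < D * (P.filter (x ∈ L ·)).card),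
        D * (P.filter (x ∈ L ·)).card := by
        rw [← smul_eq_mul]
        exact Finset.card_nsmul_le_sum _ _ _ fun c hc => (Finset.mem_filter.1 hc).2.le
    _ ≤ ∑ x, D * (P.filter (x ∈ L ·)).card :=
        Finset.sum_le_sum_of_subset (Finset.filter_subset _ _)
    _ = D * ∑ f ∈ P, (L f).card := by
        rw [← Finset.mul_sum]
        congr 1
        simp only [Finset.card_filter]
        rw [Finset.sum_comm]
        refine Finset.sum_congr rfl fun f _ => ?_
        rw [← Finset.card_filter, Finset.filter_mem_eq_inter, Finset.univ_inter]
    _ ≤ D * (M * d) := by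
        refine Nat.mul_le_mul_left _ ((Finset.sum_le_card_nsmul _ _ d fun f _ => hL f).trans ?_)
        rw [smul_eq_mul]
        exact Nat.mul_le_mul_right _ hP
    _ = _ := by ring

end Typical

section Structure

open scoped Classical

variable {V : Type*} [Fintype V] {r t K : ℕ} {H : Finset (Finset V)} {S : Finset V}
  {L : Finset V → Finset V} {f : Finset V}

theorem Typical.subset_of_subset_richType (hf : Typical r H K S L f)
    (hH : ∀ e ∈ H, e.card = r + 3) (hfree : ∀ U v, ¬ PathTo H (2 * t + 1) U v)
    (hL : ∀ f, ∀ x ∈ L f, x ∉ f ∧ insert x f ∈ H) (hK : (r + 3) * (2 * t + 1) + t + 1 ≤ K)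
    {z : V} (hz : z ∈ f) {A : Finset V} (hA : A ⊆ richType H K S z) (hAt : A.card = t) :
    L f ⊆ A := by
  intro x hx
  by_contra hxA
  subst hAt
  obtain ⟨U, v, hp⟩ := exists_pathTo_of_rich hH (by omega) (hf.card_class z hz) (A := A)
    (fun s hs z' hz' => by
      have hs' := hA hs
      rw [← (Finset.mem_filter.1 hz').2] at hs'
      exact (Finset.mem_filter.1 hs').2) hK (hL f x hx).2
    (Finset.disjoint_insert_left.2 ⟨hxA, Finset.disjoint_right.2 fun s hs =>
      hf.notMem s (Finset.mem_filter.1 (hA hs)).1⟩) (Finset.mem_insert_of_mem hz)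
    (Finset.mem_filter.2 ⟨Finset.mem_univ _, rfl⟩)
  exact hfree U v hp

theorem Typical.card_inter_add_one (hf : Typical r H K S L f) :
    (L f).card ≤ (L f ∩ S).card + if r = 0 then 1 else 0 := by
  have := Finset.card_inter_add_card_sdiff (L f) S
  have := hf.card_sdiff
  omega

theorem Typical.card_le (hf : Typical r H K S L f) (hne : f.Nonempty)
    (hH : ∀ e ∈ H, e.card = r + 3) (hfree : ∀ U v, ¬ PathTo H (2 * t + 1) U v)
    (hL : ∀ f, ∀ x ∈ L f, x ∉ f ∧ insert x f ∈ H) (hK : (r + 3) * (2 * t + 1) + t + 1 ≤ K) :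
    (L f).card ≤ t := by
  by_contra! hlt
  obtain ⟨z, hz⟩ := hne
  have := hf.card_inter_add_one
  obtain ⟨A, hA, hAt⟩ := Finset.exists_subset_card_eq
    (show t ≤ (L f ∩ S).card by split_ifs at this <;> omega)
  have := Finset.card_le_card (hf.subset_of_subset_richType hH hfree hL hK hz
    (fun s hs => hf.mem_richType s (Finset.mem_inter.1 (hA hs)).2 (Finset.mem_inter.1 (hA hs)).1
      z hz) hAt)
  omega

theorem Typical.richType_eq (hf : Typical r H K S L f) (ht : 1 ≤ t) (hft : (L f).card = t)
    (hH : ∀ e ∈ H, e.card = r + 3) (hfree : ∀ U v, ¬ PathTo H (2 * t + 1) U v)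
    (hL : ∀ f, ∀ x ∈ L f, x ∉ f ∧ insert x f ∈ H) (hK : (r + 3) * (2 * t + 1) + t + 1 ≤ K)
    {z : V} (hz : z ∈ f) : richType H K S z = L f ∩ S := by
  have hsub : L f ∩ S ⊆ richType H K S z := fun s hs =>
    hf.mem_richType s (Finset.mem_inter.1 hs).2 (Finset.mem_inter.1 hs).1 z hz
  by_contra hne
  obtain ⟨s, hs, hsL⟩ := Finset.exists_of_ssubset (hsub.ssubset_of_ne (Ne.symm hne))
  have hlt := Finset.card_lt_card (hsub.ssubset_of_ne (Ne.symm hne))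
  have := hf.card_inter_add_one
  obtain ⟨A, hsA, hA, hAt⟩ := Finset.exists_subsuperset_card_eq (n := t)
    (Finset.singleton_subset_iff.2 hs) (by simpa using ht) (by split_ifs at this <;> omega)
  have hLA := hf.subset_of_subset_richType hH hfree hL hK hz hA hAt
  have hLA' := Finset.eq_of_subset_of_card_le hLA (by omega)
  refine hsL (Finset.mem_inter.2 ⟨?_, (Finset.mem_filter.1 hs).1⟩)
  rw [hLA']
  exact hsA (Finset.mem_singleton_self s)

end Structure

theorem Nat.choose_le_choose_sub_add (n q i : ℕ) :
    n.choose (q + 1) ≤ (n - i).choose (q + 1) + i * n ^ q := by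
  induction i with
  | zero => simp
  | succ i ih =>
    refine ih.trans ?_
    rcases Nat.eq_zero_or_pos (n - i) with h | h
    · rw [h, show n - (i + 1) = 0 by omega, add_mul]
      omega
    · obtain ⟨m, hm⟩ : ∃ m, n - i = m + 1 := ⟨n - i - 1, by omega⟩
      rw [hm, show n - (i + 1) = m by omega, Nat.choose_succ_succ']
      have h1 : m.choose q ≤ n ^ q :=
        (Nat.choose_le_pow m q).trans (Nat.pow_le_pow_left (by omega) q)
      rw [add_mul, one_mul]
      omega

theorem Nat.pow_le_mul_choose {n q : ℕ} (h : 2 * q + 2 ≤ n) :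
    n ^ q ≤ 2 ^ q * q.factorial * (n - 2).choose q := by
  have h1 := Nat.pow_sub_le_descFactorial (n - 2) q
  rw [Nat.descFactorial_eq_factorial_mul_choose] at h1
  calc n ^ q ≤ (2 * (n - 2 + 1 - q)) ^ q := Nat.pow_le_pow_left (by omega) q
    _ = 2 ^ q * (n - 2 + 1 - q) ^ q := mul_pow _ _ _
    _ ≤ 2 ^ q * (q.factorial * (n - 2).choose q) := Nat.mul_le_mul_left _ h1
    _ = _ := by ring

section Class

open scoped Classical

variable {V : Type*} [Fintype V]

theorem choose_le_card_filter_superset (A : Finset V) (r : ℕ) :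
    (Fintype.card V - A.card).choose r ≤
      ((Finset.powersetCard (r + A.card) Finset.univ).filter fun f => A ⊆ f).card := by
  rw [← Finset.card_compl, ← Finset.card_powersetCard]
  have hdisj : ∀ f ∈ Finset.powersetCard r Aᶜ, Disjoint f A := fun f hf =>
    Finset.disjoint_left.2 fun x hx =>
      Finset.mem_compl.1 ((Finset.mem_powersetCard.1 hf).1 hx)
  refine Finset.card_le_card_of_injOn (· ∪ A) ?_ ?_
  · intro f hf
    have hd := hdisj f hf
    rw [Finset.mem_coe, Finset.mem_powersetCard] at hf
    rw [Finset.mem_coe, Finset.mem_filter, Finset.mem_powersetCard,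
      Finset.card_union_of_disjoint hd, hf.2]
    exact ⟨⟨Finset.subset_univ _, rfl⟩, Finset.subset_union_right⟩
  · intro f hf g hg hfg
    simp only at hfg
    rw [← Finset.union_sdiff_cancel_right (hdisj f hf), hfg,
      Finset.union_sdiff_cancel_right (hdisj g hg)]

/-- If almost all sets are monochromatic, then almost all vertices have the same colour. -/
theorem exists_large_colour_class {β : Type*} {r b c M : ℕ} (τ : V → β) {G : Finset (Finset V)}
    (hG : ∀ f ∈ G, ∀ y ∈ f, ∀ z ∈ f, τ y = τ z)
    (hc : c = 2 ^ (r + 1) * (r + 1).factorial) (hM : c * (r + 2) ^ 2 * b ≤ M)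
    (hM' : c * (r + 2) < M) (hn : 2 * r + 4 ≤ Fintype.card V)
    (hcard : M * ((Finset.powersetCard (r + 2) Finset.univ) \ G).card ≤
      Fintype.card V ^ (r + 2)) :
    ∃ z, (∃ f ∈ G, z ∈ f) ∧
      b * (Finset.univ.filter fun z' => τ z' ≠ τ z).card ≤ Fintype.card V := by
  set N := Fintype.card V with hN
  set P : Finset (Finset V) := Finset.powersetCard (r + 2) Finset.univ with hP
  set X := P \ G with hX
  have hN0 : 0 < N := by omega
  have hc0 : 0 < c := by rw [hc]; positivity
  have hne : Nonempty V := Fintype.card_pos_iff.1 hN0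
  have hXcard : ∀ f ∈ X, f.card = r + 2 := fun f hf =>
    (Finset.mem_powersetCard.1 (Finset.mem_sdiff.1 hf).1).2
  obtain ⟨z, hz⟩ : ∃ z, N * (X.filter (z ∈ ·)).card ≤ (r + 2) * X.card := by
    by_contra! hcon
    have h1 := Finset.sum_lt_sum_of_nonempty (Finset.univ_nonempty (α := V))
      fun z _ => hcon z
    rw [Finset.sum_const, smul_eq_mul, Finset.card_univ, ← Finset.mul_sum,
      sum_card_filter_mem_eq, Finset.sum_congr rfl hXcard, Finset.sum_const, smul_eq_mul,
      mul_comm (r + 2)] at h1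
    exact lt_irrefl _ h1
  have hMz : M * (N * (X.filter (z ∈ ·)).card) ≤ (r + 2) * N ^ (r + 2) := by
    calc _ ≤ M * ((r + 2) * X.card) := Nat.mul_le_mul_left _ hz
      _ = (r + 2) * (M * X.card) := by ring
      _ ≤ _ := Nat.mul_le_mul_left _ hcard
  refine ⟨z, ?_, ?_⟩
  · by_contra! hcon
    have h1 : (N - 2).choose (r + 1) ≤ (X.filter (z ∈ ·)).card := by
      refine (Nat.choose_le_choose _ (by omega : N - 2 ≤ N - 1)).trans ?_
      have := choose_le_card_filter_superset {z} (r + 1)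
      rw [Finset.card_singleton] at this
      refine this.trans (Finset.card_le_card fun f hf => ?_)
      rw [Finset.mem_filter, Finset.singleton_subset_iff] at hf
      exact Finset.mem_filter.2 ⟨Finset.mem_sdiff.2 ⟨hf.1, fun h => hcon f h hf.2⟩, hf.2⟩
    have h2 : N ^ (r + 1) ≤ c * (X.filter (z ∈ ·)).card := by
      rw [hc]
      exact (Nat.pow_le_mul_choose (by omega)).trans (Nat.mul_le_mul_left _ h1)
    have h3 : M * N ^ (r + 2) ≤ c * (r + 2) * N ^ (r + 2) := by
      calc M * N ^ (r + 2) = M * N * N ^ (r + 1) := by ring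
        _ ≤ M * N * (c * (X.filter (z ∈ ·)).card) := Nat.mul_le_mul_left _ h2
        _ = c * (M * (N * (X.filter (z ∈ ·)).card)) := by ring
        _ ≤ c * ((r + 2) * N ^ (r + 2)) := Nat.mul_le_mul_left _ hMz
        _ = _ := by ring
    exact absurd (Nat.le_of_mul_le_mul_right h3 (by positivity)) (by omega)
  · set D := Finset.univ.filter fun z' => τ z' ≠ τ z with hD
    have h1 : ∀ z' ∈ D, N ^ r ≤ c * ((X.filter (z ∈ ·)).filter (z' ∈ ·)).card := by
      intro z' hz'
      have hτ := (Finset.mem_filter.1 hz').2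
      have hzz : z ≠ z' := fun h => hτ (by rw [h])
      have := choose_le_card_filter_superset {z, z'} r
      rw [Finset.card_pair hzz] at this
      have h2 : (N - 2).choose r ≤ ((X.filter (z ∈ ·)).filter (z' ∈ ·)).card := by
        refine this.trans (Finset.card_le_card fun f hf => ?_)
        rw [Finset.mem_filter, Finset.insert_subset_iff, Finset.singleton_subset_iff] at hf
        exact Finset.mem_filter.2 ⟨Finset.mem_filter.2 ⟨Finset.mem_sdiff.2
          ⟨hf.1, fun h => hτ (hG f h z' hf.2.2 z hf.2.1)⟩, hf.2.1⟩, hf.2.2⟩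
      refine (Nat.pow_le_mul_choose (by omega)).trans (Nat.mul_le_mul ?_ h2)
      rw [hc]
      exact Nat.mul_le_mul (Nat.pow_le_pow_right (by omega) (by omega))
        (Nat.factorial_le (by omega))
    have h2 : D.card * N ^ r ≤ c * ((r + 2) * (X.filter (z ∈ ·)).card) := by
      calc _ ≤ ∑ z' ∈ D, c * ((X.filter (z ∈ ·)).filter (z' ∈ ·)).card := by
            rw [← smul_eq_mul]
            exact Finset.card_nsmul_le_sum _ _ _ h1
        _ ≤ ∑ z', c * ((X.filter (z ∈ ·)).filter (z' ∈ ·)).card :=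
            Finset.sum_le_sum_of_subset (Finset.filter_subset _ _)
        _ = _ := by
            rw [← Finset.mul_sum, sum_card_filter_mem_eq, Finset.sum_congr rfl fun f hf =>
              hXcard f (Finset.mem_filter.1 hf).1, Finset.sum_const, smul_eq_mul,
              mul_comm (r + 2)]
    refine Nat.le_of_mul_le_mul_left (c := c * (r + 2) ^ 2 * N ^ (r + 1)) ?_ (by positivity)
    calc c * (r + 2) ^ 2 * N ^ (r + 1) * (b * D.card)
        = c * (r + 2) ^ 2 * b * (N * (D.card * N ^ r)) := by ring
      _ ≤ M * (N * (c * ((r + 2) * (X.filter (z ∈ ·)).card))) :=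
          Nat.mul_le_mul hM (Nat.mul_le_mul_left _ h2)
      _ = c * (r + 2) * (M * (N * (X.filter (z ∈ ·)).card)) := by ring
      _ ≤ c * (r + 2) * ((r + 2) * N ^ (r + 2)) := Nat.mul_le_mul_left _ hMz
      _ = _ := by ring

end Class

section FullType

open scoped Classical

variable {V : Type*} [Fintype V]

theorem card_filter_mem_mem_le_of_not_rich {r K : ℕ} {H : Finset (Finset V)}
    (hH : ∀ e ∈ H, e.card = r + 3) {s z : V} (hsz : s ≠ z) (h : ¬ Rich H K s z) :
    (H.filter fun e => s ∈ e ∧ z ∈ e).card ≤ K * Fintype.card V ^ r := by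
  refine le_trans (Finset.card_le_card_of_injOn (·.erase s) ?_ ?_) (card_filter_not_rich_le r h)
  · intro e he
    obtain ⟨he, hse, hze⟩ := Finset.mem_filter.1 he
    rw [Finset.mem_coe, Finset.mem_filter, Finset.mem_powersetCard, Finset.card_erase_of_mem hse,
      hH e he, Finset.insert_erase hse]
    exact ⟨⟨Finset.subset_univ _, rfl⟩, Finset.mem_erase.2 ⟨hsz.symm, hze⟩,
      Finset.notMem_erase s e, he⟩
  · intro e he e' he' hee
    simp only at hee
    rw [← Finset.insert_erase (Finset.mem_filter.1 he).2.1, hee,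
      Finset.insert_erase (Finset.mem_filter.1 he').2.1]

/-- A hypergraph with no linear path of length `2 * t + 1` and as many edges as there are sets
meeting a `t`-set `A` consists of these sets if almost all vertices are richly connected to `A`. -/
theorem eq_filter_not_disjoint_of_rich {r t K b c : ℕ} {H : Finset (Finset V)}
    (hH : ∀ e ∈ H, e.card = r + 3) (hfree : ∀ U v, ¬ PathTo H (2 * t + 1) U v)
    {A : Finset V} (hA : A.card = t) (ht : 1 ≤ t)
    (hZ : K < (Finset.univ.filter fun z => ∀ s ∈ A, Rich H K s z).card)
    (hK : (r + 3) * (2 * t + 1) + t + 1 ≤ K)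
    (hc : c = 2 ^ (r + 1) * (r + 1).factorial)
    (hb : 2 * c * (r + 3) * ((r + 3) * (2 * t + 1)) ≤ b)
    (hX : b * (Finset.univ.filter fun z => ¬ ∀ s ∈ A, Rich H K s z).card ≤ Fintype.card V)
    (hn : 2 * c * K < Fintype.card V) (hn' : 2 * r + 4 ≤ Fintype.card V)
    (hcard : H.card = ((Finset.powersetCard (r + 3) Finset.univ).filter
      fun e => ¬ Disjoint e A).card) :
    H = (Finset.powersetCard (r + 3) Finset.univ).filter fun e => ¬ Disjoint e A := by
  set N := Fintype.card V with hN
  set F := (Finset.powersetCard (r + 3) Finset.univ).filter fun e => ¬ Disjoint e A with hF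
  set Z := Finset.univ.filter fun z => ∀ s ∈ A, Rich H K s z with hZdef
  set X := (Finset.univ.filter fun z => ¬ ∀ s ∈ A, Rich H K s z) \ A with hXdef
  have hXN : b * X.card ≤ N :=
    (Nat.mul_le_mul_left _ (Finset.card_le_card Finset.sdiff_subset)).trans hX
  have hc0 : 0 < c := by rw [hc]; positivity
  have hHP : H ⊆ Finset.powersetCard (r + 3) Finset.univ := fun e he =>
    Finset.mem_powersetCard.2 ⟨Finset.subset_univ _, hH e he⟩
  set H₀ := H.filter fun e => Disjoint e A with hH₀
  have hH₀X : ∀ e ∈ H₀, e ⊆ X := by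
    intro e he x hx
    obtain ⟨he, hd⟩ := Finset.mem_filter.1 he
    refine Finset.mem_sdiff.2 ⟨Finset.mem_filter.2 ⟨Finset.mem_univ _, fun hr => ?_⟩,
      Finset.disjoint_left.1 hd hx⟩
    subst hA
    obtain ⟨U, v, hp⟩ := exists_pathTo_of_rich hH (by omega) hZ
      (fun s hs z hz => (Finset.mem_filter.1 hz).2 s hs) hK he hd hx
      (Finset.mem_filter.2 ⟨Finset.mem_univ _, hr⟩)
    exact hfree U v hp
  have hH₀card : H₀.card ≤ (r + 3) * (2 * t + 1) * X.card ^ (r + 2) :=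
    card_le_of_pathFree (by omega) (fun e he => hH e (Finset.mem_filter.1 he).1)
      (fun U v hp => hfree U v (hp.mono (Finset.filter_subset _ _))) hH₀X
  have hM : (F \ H).card = H₀.card := by
    have h1 := Finset.card_sdiff_add_card_inter F H
    have h2 : H₀.card + (H.filter fun e => ¬ Disjoint e A).card = H.card :=
      Finset.card_filter_add_card_filter_not _
    have h3 : H.filter (fun e => ¬ Disjoint e A) = F ∩ H := by
      ext e
      simp only [hF, Finset.mem_filter, Finset.mem_inter]
      exact ⟨fun h => ⟨⟨hHP h.1, h.2⟩, h.1⟩, fun h => ⟨h.2, h.1.2⟩⟩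
    rw [h3] at h2
    omega
  have hXM : ∀ x ∈ X, (N - 2).choose (r + 1) ≤
      ((F \ H).filter (x ∈ ·)).card + K * N ^ r := by
    intro x hx
    obtain ⟨hx, hxA⟩ := Finset.mem_sdiff.1 hx
    have hx := (Finset.mem_filter.1 hx).2
    push Not at hx
    obtain ⟨s, hs, hr⟩ := hx
    have hsx : s ≠ x := fun h => hxA (h ▸ hs)
    have h1 := choose_le_card_filter_superset {s, x} (r + 1)
    rw [Finset.card_pair hsx] at h1
    refine (h1.trans (Finset.card_le_card fun e he => ?_)).trans
      ((Finset.card_union_le ((F \ H).filter (x ∈ ·)) (H.filter fun e => s ∈ e ∧ x ∈ e)).trans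
      (Nat.add_le_add_left (card_filter_mem_mem_le_of_not_rich hH hsx hr) _))
    rw [Finset.mem_filter, Finset.insert_subset_iff, Finset.singleton_subset_iff] at he
    obtain ⟨heP, hse, hxe⟩ := he
    by_cases heH : e ∈ H
    · exact Finset.mem_union_right _ (Finset.mem_filter.2 ⟨heH, hse, hxe⟩)
    · refine Finset.mem_union_left _ (Finset.mem_filter.2 ⟨Finset.mem_sdiff.2
        ⟨Finset.mem_filter.2 ⟨heP, ?_⟩, heH⟩, hxe⟩)
      exact Finset.not_disjoint_iff.2 ⟨s, hse, hs⟩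
  have hXe : X = ∅ := by
    by_contra hne
    have hX0 : 0 < X.card := Finset.card_pos.2 (Finset.nonempty_iff_ne_empty.2 hne)
    have h1 : X.card * (N - 2).choose (r + 1) ≤ (r + 3) * H₀.card + X.card * (K * N ^ r) := by
      calc X.card * (N - 2).choose (r + 1)
          ≤ ∑ x ∈ X, (((F \ H).filter (x ∈ ·)).card + K * N ^ r) := by
            rw [← smul_eq_mul]
            exact Finset.card_nsmul_le_sum _ _ _ hXM
        _ = ∑ x ∈ X, ((F \ H).filter (x ∈ ·)).card + X.card * (K * N ^ r) := by
            rw [Finset.sum_add_distrib, Finset.sum_const, smul_eq_mul]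
        _ ≤ ∑ x, ((F \ H).filter (x ∈ ·)).card + X.card * (K * N ^ r) :=
            Nat.add_le_add_right (Finset.sum_le_sum_of_subset (Finset.subset_univ _)) _
        _ = _ := by
            rw [sum_card_filter_mem_eq, Finset.sum_congr rfl fun e he =>
              (Finset.mem_powersetCard.1 (Finset.mem_filter.1 (Finset.mem_sdiff.1 he).1).1).2,
              Finset.sum_const, smul_eq_mul, hM, mul_comm (r + 3)]
    have h2 : (N - 2).choose (r + 1) ≤
        (r + 3) * ((r + 3) * (2 * t + 1)) * X.card ^ (r + 1) + K * N ^ r := by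
      refine Nat.le_of_mul_le_mul_left (c := X.card) ?_ hX0
      refine h1.trans ?_
      rw [mul_add]
      refine Nat.add_le_add_right ((Nat.mul_le_mul_left _ hH₀card).trans_eq ?_) _
      ring
    have h3 : N ^ (r + 1) ≤ c * (N - 2).choose (r + 1) := by
      rw [hc]
      exact Nat.pow_le_mul_choose (by omega)
    have h4 : b * X.card ^ (r + 1) ≤ N ^ (r + 1) :=
      calc b * X.card ^ (r + 1) = (b * X.card) * X.card ^ r := by ring
        _ ≤ N * N ^ r := Nat.mul_le_mul hXN (Nat.pow_le_pow_left (Finset.card_le_univ _) r)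
        _ = _ := by ring
    have h5 : 2 * c * (r + 3) * ((r + 3) * (2 * t + 1)) * X.card ^ (r + 1) ≤ N ^ (r + 1) :=
      (Nat.mul_le_mul_right _ hb).trans h4
    have h6 : 2 * c * K * N ^ r < N ^ (r + 1) := by
      rw [pow_succ']
      exact Nat.mul_lt_mul_of_pos_right hn (pow_pos (by omega) r)
    have h7 := Nat.mul_le_mul_left (2 * c) h2
    nlinarith
  have hH₀e : H₀ = ∅ := by
    refine Finset.eq_empty_of_forall_notMem fun e he => ?_
    have h1 := hH₀X e he
    rw [hXe, Finset.subset_empty] at h1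
    have := hH e (Finset.mem_filter.1 he).1
    rw [h1] at this
    simp at this
  refine Finset.eq_of_subset_of_card_le (fun e he => ?_) hcard.ge
  refine Finset.mem_filter.2 ⟨hHP he, fun hd => ?_⟩
  have : e ∈ H₀ := Finset.mem_filter.2 ⟨he, hd⟩
  rw [hH₀e] at this
  simp at this

end FullType

section DeficientType

open scoped Classical

variable {V : Type*} [Fintype V]

/-- A set with a quadratic number of incidences contains a pair of any almost complete graph. -/
theorem exists_pair_mem {G : Finset (Finset V)} {Z : Finset V}
    (hZ : Fintype.card V ≤ 16 * Z.card) (hn : 32 ≤ Fintype.card V)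
    (hG : 2000 * (Finset.powersetCard 2 Finset.univ \ G).card ≤ Fintype.card V ^ 2) :
    ∃ y ∈ Z, ∃ z ∈ Z, y ≠ z ∧ ({y, z} : Finset V) ∈ G := by
  by_contra! hcon
  have h1 : (Finset.powersetCard 2 Z).card ≤ (Finset.powersetCard 2 Finset.univ \ G).card := by
    refine Finset.card_le_card fun f hf => ?_
    rw [Finset.mem_powersetCard] at hf
    refine Finset.mem_sdiff.2 ⟨Finset.mem_powersetCard.2 ⟨Finset.subset_univ _, hf.2⟩, ?_⟩
    obtain ⟨y, z, hyz, rfl⟩ := Finset.card_eq_two.1 hf.2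
    exact hcon y (hf.1 (by simp)) z (hf.1 (by simp)) hyz
  rw [Finset.card_powersetCard, Nat.choose_two_right] at h1
  set N := Fintype.card V
  obtain ⟨m, hm⟩ : ∃ m, Z.card = m + 1 := ⟨Z.card - 1, by omega⟩
  rw [hm, Nat.add_sub_cancel] at h1
  have h2 : (m + 1) * m ≤ 2 * ((m + 1) * m / 2) := by
    have := Nat.even_mul_succ_self m
    rw [mul_comm] at this
    rw [Nat.mul_div_cancel' this.two_dvd]
  have h3 : N ≤ 32 * m := by omega
  have h4 : N * N ≤ (16 * (m + 1)) * (32 * m) := Nat.mul_le_mul (by omega) h3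
  have h5 : 0 < N * N := by positivity
  nlinarith

/-- If almost all pairs are extended by a rarely used colour outside `A` and are richly connected to
all the vertices of `A`, there is a linear path of length `2 * |A| + 3`. -/
theorem exists_pathTo_of_rare_colours {K C D : ℕ} {H G : Finset (Finset V)}
    (hH : ∀ e ∈ H, e.card = 3) (hG : G ⊆ Finset.powersetCard 2 Finset.univ) {A : Finset V}
    {a : Finset V → V} (ha : ∀ f ∈ G, a f ∉ f ∧ insert (a f) f ∈ H ∧ a f ∉ A)
    (hA : ∀ f ∈ G, Disjoint f A) (hR : ∀ f ∈ G, ∀ z ∈ f, ∀ s ∈ A, Rich H K s z)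
    (hcard : 2000 * (Finset.powersetCard 2 Finset.univ \ G).card ≤ Fintype.card V ^ 2)
    (hK : 3 * (2 * A.card + 3) + A.card + 3 ≤ K) (hC : C = 4 * 16 * (K + 1))
    (hn : C < Fintype.card V) (hD : 16 * C ^ 2 ≤ D)
    (hDa : ∀ c, D * (G.filter fun f => a f = c).card ≤ Fintype.card V ^ 2) :
    ∃ U v, PathTo H (2 * A.card + 3) U v := by
  set N := Fintype.card V with hN
  have hGcard : N ^ 2 ≤ 4 * G.card := by
    have h1 := Finset.card_sdiff_add_card_eq_card hG
    rw [Finset.card_powersetCard, Nat.choose_two_right, Finset.card_univ, ← hN] at h1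
    obtain ⟨m, hm⟩ : ∃ m, N = m + 1 := ⟨N - 1, by omega⟩
    rw [hm, Nat.add_sub_cancel] at h1
    have h2 : 2 * ((m + 1) * m / 2) = (m + 1) * m := by
      have := Nat.even_mul_succ_self m
      rw [mul_comm] at this
      rw [Nat.mul_div_cancel' this.two_dvd]
    rw [hm] at hcard ⊢
    have h3 : 10 ≤ m := by omega
    nlinarith
  set G₀ := G.filter fun f => ∃ y ∈ f, ∃ z ∈ f, y ≠ z ∧ LocallyHeavy 0 C G a y (a f) ∧
      LocallyHeavy 0 C G a z (a f) with hG₀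
  have hG₀card : 8 * G₀.card ≤ N ^ 2 := by
    have h1 : D * G₀.card ≤ C ^ 2 * 2 * N ^ 2 := mul_card_doubly_heavy_le (r := 0) hG hDa
    have h2 := (Nat.mul_le_mul_right G₀.card hD).trans h1
    have hC0 : 0 < C := by omega
    refine Nat.le_of_mul_le_mul_left (c := C ^ 2 * 2) ?_ (by positivity)
    refine le_trans (le_of_eq ?_) h2
    ring
  set light : V → Finset (Finset V) := fun z =>
    (G \ G₀).filter fun f => z ∈ f ∧ ¬ LocallyHeavy 0 C G a z (a f) with hlight
  have hlightle : ∀ z, (light z).card ≤ N := fun z => by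
    refine (Finset.card_le_card fun f hf => ?_).trans
      ((card_filter_mem_le 1 z).trans_eq (pow_one N))
    obtain ⟨hf, hz, -⟩ := Finset.mem_filter.1 hf
    exact Finset.mem_filter.2 ⟨hG (Finset.mem_sdiff.1 hf).1, hz⟩
  have hsum : (G \ G₀).card ≤ ∑ z, (light z).card := by
    refine (Finset.card_le_card (t := Finset.univ.biUnion light) fun f hf => ?_).trans
      Finset.card_biUnion_le
    obtain ⟨hfG, hf₀⟩ := Finset.mem_sdiff.1 hf
    obtain ⟨y, z, hyz, rfl⟩ := Finset.card_eq_two.1 (Finset.mem_powersetCard.1 (hG hfG)).2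
    rw [Finset.mem_biUnion]
    by_cases hy : LocallyHeavy 0 C G a y (a {y, z})
    · refine ⟨z, Finset.mem_univ _, Finset.mem_filter.2 ⟨hf, by simp, fun hz => hf₀ ?_⟩⟩
      exact Finset.mem_filter.2 ⟨hfG, y, by simp, z, by simp, hyz, hy, hz⟩
    · exact ⟨y, Finset.mem_univ _, Finset.mem_filter.2 ⟨hf, by simp, hy⟩⟩
  set Z := Finset.univ.filter fun z => N ≤ 16 * (light z).card with hZ
  have hZcard : N ≤ 16 * Z.card := by
    have h1 : 16 * ∑ z, (light z).card ≤ 16 * (Z.card * N) + N * N := by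
      rw [← Finset.sum_filter_add_sum_filter_not Finset.univ (fun z => N ≤ 16 * (light z).card),
        mul_add]
      refine Nat.add_le_add (Nat.mul_le_mul_left _ (Finset.sum_le_card_nsmul _ _ N
        fun z _ => hlightle z)) ?_
      rw [Finset.mul_sum]
      refine (Finset.sum_le_card_nsmul _ _ N fun z hz => ?_).trans ?_
      · exact (not_le.1 (Finset.mem_filter.1 hz).2).le
      · rw [smul_eq_mul]
        exact Nat.mul_le_mul_right _ (Finset.card_le_univ _)
    have h2 : (G \ G₀).card + G₀.card = G.card :=
      Finset.card_sdiff_add_card_eq_card (Finset.filter_subset _ _)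
    refine Nat.le_of_mul_le_mul_right (c := N) ?_ (by omega)
    nlinarith
  have hmemZ : ∀ z ∈ Z, ∃ f ∈ G, z ∈ f := by
    intro z hz
    have h1 := (Finset.mem_filter.1 hz).2
    obtain ⟨f, hf⟩ := Finset.card_pos.1 (show 0 < (light z).card by omega)
    obtain ⟨hf, hzf, -⟩ := Finset.mem_filter.1 hf
    exact ⟨f, (Finset.mem_sdiff.1 hf).1, hzf⟩
  have hRZ : ∀ s ∈ A, ∀ z ∈ Z, Rich H K s z := fun s hs z hz => by
    obtain ⟨f, hf, hzf⟩ := hmemZ z hz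
    exact hR f hf z hzf s hs
  have hext : ∀ z ∈ Z, ∀ W : Finset V, z ∉ W → W.card ≤ K →
      ∃ f ∈ G, z ∈ f ∧ Disjoint (insert (a f) f) W := by
    intro z hz W hzW hW
    obtain ⟨f, hf, hd, hfa, -⟩ := exists_avoiding (r := 0) hG
      ((Finset.filter_subset _ _).trans Finset.sdiff_subset : light z ⊆ G) a a
      (fun f hf => (Finset.mem_filter.1 hf).2.1) hzW hW
      (by simpa using (Finset.mem_filter.1 hz).2) hC hn
    obtain ⟨hf, hzf, hl⟩ := Finset.mem_filter.1 hf
    exact ⟨f, (Finset.mem_sdiff.1 hf).1, hzf, Finset.disjoint_insert_left.2 ⟨hfa hl, hd⟩⟩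
  obtain ⟨y, hy, z, hz, hyz, hyzG⟩ := exists_pair_mem hZcard (by omega) hcard
  obtain ⟨hxyz, hxH, hxA⟩ := ha _ hyzG
  set x := a {y, z} with hx
  have hyA := Finset.disjoint_left.1 (hA _ hyzG) (by simp : y ∈ ({y, z} : Finset V))
  have hzA := Finset.disjoint_left.1 (hA _ hyzG) (by simp : z ∈ ({y, z} : Finset V))
  simp only [Finset.mem_insert, Finset.mem_singleton, not_or] at hxyz
  obtain ⟨f, hf, hyf, hd⟩ := hext y hy (insert z (insert x A))
    (by simp [hyz, Ne.symm hxyz.1, hyA])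
    (((Finset.card_insert_le _ _).trans (Nat.add_le_add_right (Finset.card_insert_le _ _) 1)).trans
      (by omega))
  rw [Finset.disjoint_insert_right, Finset.disjoint_insert_right] at hd
  obtain ⟨hzf, hxf, hfA⟩ := hd
  have hp₁ := PathTo.single (ha f hf).2.1 (Finset.mem_insert_of_mem hyf)
    (by rw [hH _ (ha f hf).2.1]; omega)
  have hp₂ := hp₁.extend hxH (by simp)
    (by
      simp only [Finset.disjoint_insert_left, Finset.disjoint_singleton_left]
      exact ⟨fun h => hxf (Finset.mem_of_mem_erase h), Finset.notMem_erase _ _,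
        fun h => hzf (Finset.mem_of_mem_erase h)⟩) (w := z) (by simp) hyz.symm
  obtain ⟨U, v, hv, hp⟩ := hp₂.exists_chain hH (by omega : K < Z.card) A hRZ hz
    (by
      rw [Finset.disjoint_union_left]
      exact ⟨hfA, Finset.disjoint_insert_left.2 ⟨hxA, hA _ hyzG⟩⟩) (by omega)
  obtain ⟨g, hg, hvg, hgd⟩ := hext v hv (U.erase v) (Finset.notMem_erase _ _) (by
    have := hp.card_le hH
    rw [Finset.card_erase_of_mem hp.mem]
    omega)
  obtain ⟨w, hw, hwv⟩ := Finset.exists_mem_ne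
    (show 1 < g.card by rw [(Finset.mem_powersetCard.1 (hG hg)).2]; omega) v
  have hp₃ := hp.extend (ha g hg).2.1 (Finset.mem_insert_of_mem hvg) hgd
    (Finset.mem_insert_of_mem hw) hwv
  exact ⟨_, _, by rwa [show 2 * A.card + 3 = 1 + 1 + 2 * A.card + 1 by omega]⟩

end DeficientType

theorem Nat.choose_eq_choose_sub_add_sum (q : ℕ) {n t : ℕ} (h : t ≤ n) :
    n.choose (q + 1) = (n - t).choose (q + 1) + ∑ i ∈ Finset.Icc 1 t, (n - i).choose q := by
  induction t with
  | zero => simp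
  | succ t ih =>
    rw [ih (by omega), Finset.sum_Icc_succ_top (by omega), show n - t = n - (t + 1) + 1 by omega,
      Nat.choose_succ_succ']
    omega

theorem Nat.mul_choose_le_sum_choose_sub_add (n t q : ℕ) :
    t * n.choose (q + 1) ≤ ∑ i ∈ Finset.Icc 1 t, (n - i).choose (q + 1) + t ^ 2 * n ^ q := by
  calc t * n.choose (q + 1) = ∑ i ∈ Finset.Icc 1 t, n.choose (q + 1) := by simp
    _ ≤ ∑ i ∈ Finset.Icc 1 t, ((n - i).choose (q + 1) + t * n ^ q) := by
        refine Finset.sum_le_sum fun i hi => (Nat.choose_le_choose_sub_add n q i).trans ?_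
        exact Nat.add_le_add_left (Nat.mul_le_mul_right _ (Finset.mem_Icc.1 hi).2) _
    _ = _ := by simp [Finset.sum_add_distrib, sq, mul_assoc]

section Main

open scoped Classical

theorem card_filter_not_disjoint_eq_sum {V : Type*} [Fintype V] (q : ℕ) (A : Finset V) :
    ((Finset.powersetCard (q + 1) Finset.univ).filter fun e => ¬ Disjoint e A).card =
      ∑ i ∈ Finset.Icc 1 A.card, (Fintype.card V - i).choose q := by
  have h1 := Finset.card_filter_add_card_filter_not
    (s := Finset.powersetCard (q + 1) (Finset.univ : Finset V)) fun e => Disjoint e A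
  have h2 : ((Finset.powersetCard (q + 1) (Finset.univ : Finset V)).filter fun e => Disjoint e A) =
      Finset.powersetCard (q + 1) Aᶜ := by
    ext e
    simp only [Finset.mem_filter, Finset.mem_powersetCard, Finset.subset_univ, true_and,
      Finset.subset_compl_iff_disjoint_right]
    tauto
  rw [h2, Finset.card_powersetCard, Finset.card_powersetCard, Finset.card_compl, Finset.card_univ,
    Nat.choose_eq_choose_sub_add_sum q (Finset.card_le_univ A)] at h1
  exact Nat.add_left_cancel h1

/-- If the average of a bounded function on `P` is about `t`, which bounds it outside a small set,
then it is almost always equal to `t`. -/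
theorem card_filter_ne_le {α : Type*} [DecidableEq α] {P E : Finset α} {L : α → ℕ} {d t h R : ℕ}
    (hE : E ⊆ P) (hd : ∀ f, L f ≤ d) (hLt : ∀ f ∈ P \ E, L f ≤ t) (hs : h ≤ ∑ f ∈ P, L f)
    (hP : t * P.card ≤ h + R) :
    (P \ (P \ E).filter fun f => L f = t).card ≤ (d + 1) * E.card + R := by
  have h1 : ∑ f ∈ P \ E, L f + ((P \ E).filter fun f => ¬ L f = t).card ≤ t * (P \ E).card := by
    rw [Finset.card_filter, ← Finset.sum_add_distrib, mul_comm, ← smul_eq_mul]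
    refine Finset.sum_le_card_nsmul _ _ _ fun f hf => ?_
    have := hLt f hf
    split_ifs <;> omega
  have h2 : ∑ f ∈ P \ E, L f + ∑ f ∈ E, L f = ∑ f ∈ P, L f := Finset.sum_sdiff hE
  have h3 : ∑ f ∈ E, L f ≤ E.card * d := Finset.sum_le_card_nsmul _ _ _ fun f _ => hd f
  have h4 : (P \ E).card + E.card = P.card := Finset.card_sdiff_add_card_eq_card hE
  have h5 : (P \ (P \ E).filter fun f => L f = t).card ≤
      E.card + ((P \ E).filter fun f => ¬ L f = t).card := by
    refine (Finset.card_le_card fun f hf => ?_).trans (Finset.card_union_le _ _)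
    obtain ⟨hfP, hf⟩ := Finset.mem_sdiff.1 hf
    rw [Finset.mem_filter, Finset.mem_sdiff] at hf
    rw [Finset.mem_union, Finset.mem_filter, Finset.mem_sdiff]
    tauto
  have h6 : t * P.card = t * (P \ E).card + t * E.card := by rw [← h4, mul_add]
  nlinarith

set_option maxHeartbeats 1000000 in
/-- Large extremal hypergraphs without linear paths of odd length. -/
theorem exists_eq_filter_not_disjoint (r t : ℕ) (ht : 1 ≤ t) : ∃ n₀ : ℕ,
    ∀ (V : Type) [Fintype V], n₀ ≤ Fintype.card V → ∀ H : Finset (Finset V),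
    (∀ e ∈ H, e.card = r + 3) →
    H.card = ∑ i ∈ Finset.Icc 1 t, (Fintype.card V - i).choose (r + 2) →
    (∀ U v, ¬ PathTo H (2 * t + 1) U v) →
    ∃ A : Finset V, A.card = t ∧ ∀ e, e ∈ H ↔ e.card = r + 3 ∧ ¬ Disjoint e A := by
  obtain ⟨d, hd⟩ : ∃ d, d = (r + 3) * (2 * t + 1) := ⟨_, rfl⟩
  obtain ⟨K, hK⟩ : ∃ K, K = (r + 3) * (2 * t + 1) + t + 1 + (3 * (2 * t + 3) + t + 3) := ⟨_, rfl⟩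
  obtain ⟨c, hc⟩ : ∃ c, c = 2 ^ (r + 1) * (r + 1).factorial := ⟨_, rfl⟩
  obtain ⟨b, hb⟩ : ∃ b, b = 2 * c * (r + 3) * ((r + 3) * (2 * t + 1)) + 4000 := ⟨_, rfl⟩
  obtain ⟨M, hM⟩ : ∃ M, M = c * (r + 2) ^ 2 * b + c * (r + 2) + 4000 := ⟨_, rfl⟩
  obtain ⟨B, hB⟩ : ∃ B, B = 2 * M * (d + 1) := ⟨_, rfl⟩
  obtain ⟨C₁, hC₁⟩ : ∃ C, C = 4 * (8 * (2 * B)) * ((r + 3) * (2 * t + 1) + 1) := ⟨_, rfl⟩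
  obtain ⟨C₂, hC₂⟩ : ∃ C, C = 4 * 16 * (K + 1) := ⟨_, rfl⟩
  obtain ⟨D, hD⟩ : ∃ D, D = 4 * (2 * B) * (C₁ ^ 2 * (r + 2)) + 16 * C₂ ^ 2 := ⟨_, rfl⟩
  obtain ⟨n₁, hn₁⟩ : ∃ n₁, n₁ = 8 * (2 * B) * C₁ ^ 2 * ((r + 3) * (2 * t + 1) + 1) := ⟨_, rfl⟩
  obtain ⟨n₂, hn₂⟩ : ∃ n₂, n₂ = 2 * B * (D * d + D * d * K + K * 2 ^ (D * d)) := ⟨_, rfl⟩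
  obtain ⟨n₃, hn₃⟩ : ∃ n₃, n₃ = 2 * M * t ^ 2 + C₂ + 2 * c * K := ⟨_, rfl⟩
  refine ⟨n₁ + n₂ + n₃ + 2 * r + 2 * K + 5, fun V _ hn H hH hcard hfree => ?_⟩
  set N := Fintype.card V with hN
  set P : Finset (Finset V) := Finset.powersetCard (r + 2) Finset.univ with hP
  obtain ⟨L, hL, hLd, hLcard⟩ := exists_peeling_of_pathFree (by omega) hH hfree
  rw [← hd] at hLd
  have hPcard : P.card ≤ N ^ (r + 2) := by
    rw [hP, Finset.card_powersetCard, Finset.card_univ]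
    exact Nat.choose_le_pow _ _
  have hNpos : 0 < N := by omega
  have hScard := card_popular_le (D := D) P (M := N ^ (r + 2)) (by positivity) hPcard hLd
  set S := Finset.univ.filter fun x => N ^ (r + 2) < D * (P.filter (x ∈ L ·)).card with hSdef
  have hS : ∀ x ∉ S, D * (P.filter (x ∈ L ·)).card ≤ N ^ (r + 2) := fun x hx =>
    not_lt.1 fun h => hx (Finset.mem_filter.2 ⟨Finset.mem_univ _, h⟩)
  have hKt : (r + 3) * (2 * t + 1) + t + 1 ≤ K := by omega
  have hM0 : 1 ≤ M := by omega
  have hB1 : 1 ≤ B := by rw [hB]; exact Nat.mul_pos (by omega) (by omega)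
  set E := P.filter fun f => ¬ Typical r H K S L f with hEdef
  have hE : B * E.card ≤ N ^ (r + 2) := by
    refine mul_card_not_typical_le hH hfree hL hS hB1 hC₁ (by omega) (by omega) ?_
    refine le_trans ?_ (show n₂ ≤ N by omega)
    rw [hn₂]
    gcongr
    omega
  have htyp : ∀ f ∈ P \ E, Typical r H K S L f := fun f hf => by
    rw [Finset.mem_sdiff] at hf
    by_contra h
    exact hf.2 (Finset.mem_filter.2 ⟨hf.1, h⟩)
  set G := (P \ E).filter fun f => (L f).card = t with hGdef
  have hGP : G ⊆ P := (Finset.filter_subset _ _).trans Finset.sdiff_subset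
  have hGcard : M * (P \ G).card ≤ N ^ (r + 2) := by
    have h1 : (P \ G).card ≤ (d + 1) * E.card + t ^ 2 * N ^ (r + 1) := by
      have hEP : E ⊆ P := Finset.filter_subset _ _
      refine card_filter_ne_le hEP hLd (fun f hf => ?_) hLcard ?_
      · refine (htyp f hf).card_le ?_ hH hfree hL hKt
        rw [← Finset.card_pos, (Finset.mem_powersetCard.1 (Finset.mem_sdiff.1 hf).1).2]
        omega
      · rw [hP, Finset.card_powersetCard, Finset.card_univ, hcard]
        exact Nat.mul_choose_le_sum_choose_sub_add N t (r + 1)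
    have h2 : 2 * M * t ^ 2 * N ^ (r + 1) ≤ N ^ (r + 2) := by
      rw [pow_succ' N (r + 1)]
      exact Nat.mul_le_mul_right _ (by omega)
    rw [hB] at hE
    have h3 := Nat.mul_le_mul_left (2 * M) h1
    nlinarith
  have hτ : ∀ f ∈ G, ∀ z ∈ f, richType H K S z = L f ∩ S := fun f hf z hz =>
    (htyp f (Finset.mem_filter.1 hf).1).richType_eq ht (Finset.mem_filter.1 hf).2 hH hfree hL hKt hz
  obtain ⟨z₀, ⟨f₀, hf₀, hz₀⟩, hclass⟩ := exists_large_colour_class (b := b) (richType H K S)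
    (fun f hf y hy z hz => (hτ f hf y hy).trans (hτ f hf z hz).symm) hc (by omega) (by omega)
    (by omega) hGcard
  set A := richType H K S z₀ with hA
  have hAS : A ⊆ S := Finset.filter_subset _ _
  have hAf₀ : A = L f₀ ∩ S := hτ f₀ hf₀ z₀ hz₀
  have hAle : A.card ≤ t := by
    rw [hAf₀, ← (Finset.mem_filter.1 hf₀).2]
    exact Finset.card_le_card Finset.inter_subset_left
  have hAge := (htyp f₀ (Finset.mem_filter.1 hf₀).1).card_inter_add_one
  rw [← hAf₀, (Finset.mem_filter.1 hf₀).2] at hAge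
  set X := Finset.univ.filter fun z => richType H K S z ≠ A with hX
  replace hclass : b * X.card ≤ N := by convert hclass
  rcases hAle.eq_or_lt with hAt | hAt
  · suffices h : H = (Finset.powersetCard (r + 3) Finset.univ).filter fun e => ¬ Disjoint e A by
      refine ⟨A, hAt, fun e => ?_⟩
      rw [h, Finset.mem_filter, Finset.mem_powersetCard]
      simp
    have hXsub : (Finset.univ.filter fun z => ¬ ∀ s ∈ A, Rich H K s z) ⊆ X := fun z hz => by
      refine Finset.mem_filter.2 ⟨Finset.mem_univ _, fun h => (Finset.mem_filter.1 hz).2 ?_⟩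
      intro s hs
      rw [← h] at hs
      exact (Finset.mem_filter.1 hs).2
    have hXle := (Nat.mul_le_mul_left b (Finset.card_le_card hXsub)).trans hclass
    refine eq_filter_not_disjoint_of_rich hH hfree hAt ht ?_ hKt hc (by omega) hXle (by omega)
      (by omega) ?_
    · have h1 := Finset.card_filter_add_card_filter_not (s := (Finset.univ : Finset V))
        fun z => ∀ s ∈ A, Rich H K s z
      rw [Finset.card_univ] at h1
      have h2 := (Nat.mul_le_mul_right (Finset.univ.filter fun z => ¬ ∀ s ∈ A, Rich H K s z).card
        (show 2 ≤ b by omega)).trans hXle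
      omega
    · rw [card_filter_not_disjoint_eq_sum, hAt, hcard]
  · have hr : r = 0 := by
      by_contra hr
      rw [if_neg hr] at hAge
      omega
    subst hr
    rw [if_pos rfl] at hAge
    set G' := G.filter fun f => ∀ z ∈ f, richType H K S z = A with hG'
    have hG'typ : ∀ f ∈ G', Typical 0 H K S L f := fun f hf =>
      htyp f (Finset.mem_filter.1 (Finset.mem_filter.1 hf).1).1
    have hex : ∀ f ∈ G', ∃ a, a ∈ L f ∧ a ∉ S := by
      intro f hf
      obtain ⟨hfG, hfA⟩ := Finset.mem_filter.1 hf
      obtain ⟨z, hz⟩ : f.Nonempty := by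
        rw [← Finset.card_pos, (Finset.mem_powersetCard.1 (hGP hfG)).2]
        omega
      have h1 := hτ f hfG z hz
      rw [hfA z hz] at h1
      have h2 := Finset.card_inter_add_card_sdiff (L f) S
      rw [← h1, (Finset.mem_filter.1 hfG).2] at h2
      obtain ⟨a, ha⟩ := Finset.card_pos.1 (show 0 < (L f \ S).card by omega)
      exact ⟨a, Finset.mem_sdiff.1 ha⟩
    have : Nonempty V := ⟨z₀⟩
    choose! a haL haS using hex
    have hcompl : 2000 * (P \ G').card ≤ N ^ 2 := by
      have h1 : (P \ G').card ≤ (P \ G).card + X.card * N := by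
        refine (Finset.card_le_card
          (t := (P \ G) ∪ P.filter fun f => ∃ z ∈ X, z ∈ f) fun f hf => ?_).trans
          ((Finset.card_union_le _ _).trans (Nat.add_le_add_left
            ((card_filter_meets_le 1 X).trans_eq (by rw [pow_one])) _))
        obtain ⟨hfP, hf⟩ := Finset.mem_sdiff.1 hf
        by_cases hfG : f ∈ G
        · refine Finset.mem_union_right _ (Finset.mem_filter.2 ⟨hfP, ?_⟩)
          by_contra! hcon
          refine hf (Finset.mem_filter.2 ⟨hfG, fun z hz => ?_⟩)
          by_contra hne
          exact hcon z (Finset.mem_filter.2 ⟨Finset.mem_univ _, hne⟩) hz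
        · exact Finset.mem_union_left _ (Finset.mem_sdiff.2 ⟨hfP, hfG⟩)
      have h2 : 4000 * (P \ G).card ≤ N ^ 2 :=
        (Nat.mul_le_mul_right _ (by omega)).trans hGcard
      have h3 : 4000 * X.card ≤ N := (Nat.mul_le_mul_right _ (by omega)).trans hclass
      have h4 := Nat.mul_le_mul_right N h3
      nlinarith
    have hrare : ∀ x, D * (G'.filter fun f => a f = x).card ≤ N ^ 2 := by
      intro x
      by_cases hx : x ∈ S
      · rw [Finset.filter_false_of_mem]
        · simp
        · rintro f hf rfl
          exact haS f hf hx
      · refine le_trans (Nat.mul_le_mul_left _ (Finset.card_le_card fun f hf => ?_)) (hS x hx)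
        obtain ⟨hfG, rfl⟩ := Finset.mem_filter.1 hf
        exact Finset.mem_filter.2 ⟨hGP (Finset.mem_filter.1 hfG).1, haL f hfG⟩
    have hext : ∀ f ∈ G', a f ∉ f ∧ insert (a f) f ∈ H ∧ a f ∉ A := fun f hf =>
      ⟨(hL f _ (haL f hf)).1, (hL f _ (haL f hf)).2, fun h => haS f hf (hAS h)⟩
    have hdisj : ∀ f ∈ G', Disjoint f A := fun f hf =>
      Finset.disjoint_right.2 fun s hs => (hG'typ f hf).notMem s (hAS hs)
    have hrich : ∀ f ∈ G', ∀ z ∈ f, ∀ s ∈ A, Rich H K s z := fun f hf z hz s hs => by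
      rw [← (Finset.mem_filter.1 hf).2 z hz] at hs
      exact (Finset.mem_filter.1 hs).2
    obtain ⟨U, v, hp⟩ := exists_pathTo_of_rare_colours hH ((Finset.filter_subset _ _).trans hGP)
      hext hdisj hrich hcompl (by omega) hC₂ (by omega) (by omega) hrare
    refine absurd hp ?_
    rw [show 2 * A.card + 3 = 2 * t + 1 by omega]
    exact hfree U v

end Main

/-- Theorem 1, odd case, extremal structure: for `k ≥ 3` and sufficiently large `n`, any
extremal `k`-uniform hypergraph with no linear path of length `2t+1` consists of all
`k`-sets meeting a fixed `t`-set `S`. -/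
theorem extremal_linear_path_odd (k t : ℕ) (hk : 3 ≤ k) (ht : 1 ≤ t) :
    ∃ n₀ : ℕ, ∀ n ≥ n₀, ∀ H : Finset (Finset (Fin n)),
      (∀ e ∈ H, e.card = k) →
      H.card = ∑ i ∈ Finset.Icc 1 t, Nat.choose (n - i) (k - 1) →
      (¬ ∃ A : Fin (2 * t + 1) → Finset (Fin n),
          IsLinearPath k (2 * t + 1) A ∧ ∀ i, A i ∈ H) →
      ∃ S : Finset (Fin n), S.card = t ∧
        ∀ e : Finset (Fin n), e ∈ H ↔ e.card = k ∧ (e ∩ S).Nonempty := by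
  obtain ⟨r, rfl⟩ : ∃ r, k = r + 3 := ⟨k - 3, by omega⟩
  obtain ⟨n₀, h⟩ := exists_eq_filter_not_disjoint r t ht
  refine ⟨n₀, fun n hn H hH hcard hfree => ?_⟩
  obtain ⟨S, hS, hHS⟩ := h (Fin n) (by simpa using hn) H hH (by simpa using hcard) fun U v hp =>
    hfree (PathTo.exists_isLinearPath (U := U) (v := v) (by convert hp) hH)
  refine ⟨S, hS, fun e => ?_⟩
  rw [hHS, Finset.not_disjoint_iff_nonempty_inter]
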